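/- Let n = 2^{a_1} + ⋯ + 2^{a_r} with a_1 > a_2 > ⋯ > a_r ≥ 0, let λ ⊢_o n, and let j ∈ ℕ with 2^j ≤ n. Let k ∈ ℕ with 0 ≤ k ≤ j, write Q_2^{(k)}(λ) = (λ_1, …, λ_{2^k}), and let a_t = min{a_i : a_i ≥ j}. Then there is a unique s ∈ {1, …, 2^k} such that 2^{a_t − k} is a binary digit of |λ_s|, and R_k^j(λ) = λ_s. -/

import Mathlib

namespace OddSym

open scoped Classical

/-- Remove one box from a row of size `p` (as multisets of parts). -/
def removeBox (lam : Multiset ℕ) (p : ℕ) : Multiset ℕ :=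
  if p ≤ 1 then lam.erase p else (p - 1) ::ₘ lam.erase p

lemma removeBox_sum_lt {lam : Multiset ℕ} {p : ℕ} (hp : p ∈ lam) (h0 : 0 < p) :
    (removeBox lam p).sum < lam.sum := by
  have h : p + (lam.erase p).sum = lam.sum := by
    conv_rhs => rw [← Multiset.cons_erase hp]
    simp [Multiset.sum_cons]
  unfold removeBox
  split
  · omega
  · simp only [Multiset.sum_cons]
    omega

/-- The number of standard Young tableaux of shape `lam`
(equivalently, the degree of the irreducible character of the symmetric
group labelled by `lam`), defined via the branching rule. -/
def degSYT (lam : Multiset ℕ) : ℕ :=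
  if _h : lam = 0 then 1
  else ∑ p ∈ (lam.toFinset.filter (fun p => 0 < p)).attach, degSYT (removeBox lam p.1)
termination_by lam.sum
decreasing_by
  have hp := p.2
  simp only [Finset.mem_filter, Multiset.mem_toFinset] at hp
  exact removeBox_sum_lt hp.1 hp.2

/-- `lam` is an odd partition: all parts positive and the number of standard
Young tableaux of shape `lam` (= the character degree) is odd. -/
def OddP (lam : Multiset ℕ) : Prop :=
  (∀ x ∈ lam, 0 < x) ∧ Odd (degSYT lam)

/-- The parts of `lam` sorted in weakly decreasing order. -/
def descList (lam : Multiset ℕ) : List ℕ :=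
  (lam.sort (· ≤ ·)).reverse

/-- The beta-set (set of beta-numbers) of `lam` with `m` beads:
`{ lam_i + (m - i) : 1 ≤ i ≤ m }` where `lam` is padded with zero parts. -/
def betaSet (lam : Multiset ℕ) (m : ℕ) : Finset ℕ :=
  (Finset.range m).image (fun i => (descList lam).getD i 0 + (m - 1 - i))

/-- `mu` is obtained from `lam` by removing an `e`-hook: in some beta-set of
`lam` a beta-number `x` is replaced by `x - e` (which is not a beta-number). -/
def IsHookRemoval (e : ℕ) (lam mu : Multiset ℕ) : Prop :=
  (∀ x ∈ lam, 0 < x) ∧ (∀ x ∈ mu, 0 < x) ∧ 0 < e ∧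
  ∃ m x, Multiset.card lam ≤ m ∧ Multiset.card mu ≤ m ∧
    x ∈ betaSet lam m ∧ e ≤ x ∧ x - e ∉ betaSet lam m ∧
    betaSet mu m = insert (x - e) ((betaSet lam m).erase x)

/-- The map `f_k` : for an odd partition `lam` with `2^k ≤ |lam|`, the unique
odd partition obtained from `lam` by removing a `2^k`-hook (junk value `0` if
no such partition exists). -/
noncomputable def fkOp (k : ℕ) (lam : Multiset ℕ) : Multiset ℕ :=
  if h : ∃ mu, IsHookRemoval (2 ^ k) lam mu ∧ OddP mu then h.choose else 0

/-- The partition encoded by a finite beta-set: each bead contributes a part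
equal to the number of gaps below it. -/
def partOfBeta (S : Finset ℕ) : Multiset ℕ :=
  (S.val.map (fun b => b - (S.filter (fun a => a < b)).card)).filter (fun p => 0 < p)

/-- The 2-quotient `(lam_0, lam_1)` of `lam`, computed from a beta-set with an
even number of beads via the two runners of the 2-abacus. -/
def quot2 (lam : Multiset ℕ) : Multiset ℕ × Multiset ℕ :=
  (partOfBeta (((betaSet lam (2 * Multiset.card lam)).filter (fun b => b % 2 = 0)).image
      (fun b => b / 2)),
   partOfBeta (((betaSet lam (2 * Multiset.card lam)).filter (fun b => b % 2 = 1)).image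
      (fun b => b / 2)))

/-- The `e`-core of `lam`: push all beads of an `e`-abacus configuration for
`lam` up as far as possible. -/
def coreP (e : ℕ) (lam : Multiset ℕ) : Multiset ℕ :=
  partOfBeta ((Finset.range (e * (Multiset.card lam + e))).filter
    (fun x => x / e <
      ((betaSet lam (Multiset.card lam + e)).filter (fun b => b % e = x % e)).card))

/-- Row `k` of the 2-quotient tower of `lam`: row 0 is `[lam]`, and row `k+1`
replaces each entry of row `k` by its 2-quotient pair. -/
def towerRow : ℕ → Multiset ℕ → List (Multiset ℕ)
  | 0, lam => [lam]
  | (k + 1), lam => (towerRow k lam).flatMap (fun mu => [(quot2 mu).1, (quot2 mu).2])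

/-- `R_k^j(lam)`: the component of row `k` of the 2-quotient tower of `lam`
from which a `2^(j-k)`-hook is removed in the passage from `lam` to `f_j(lam)`;
it is characterized by: row `k` for `f_j(lam)` is obtained from row `k` for
`lam` by replacing this component by its image under `f_(j-k)`. -/
noncomputable def Rcomp (k j : ℕ) (lam : Multiset ℕ) : Multiset ℕ :=
  if h : ∃ s, s < 2 ^ k ∧
      towerRow k (fkOp j lam) =
        (towerRow k lam).set s (fkOp (j - k) ((towerRow k lam).getD s 0))
  then (towerRow k lam).getD h.choose 0 else 0

/-! ### Counting bead moves modulo two -/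

/-- The parity of the number of ways to move the beads at the positions `v i` (`i ∈ I`), one step
down at a time and `n` times in total, so as to reach the positions `0, …, #I - 1`. Configurations
with two beads in the same place may be visited: they contribute an even number of ways. -/
noncomputable def pathPar (I : Finset ℕ) : ℕ → (ℕ → ℕ) → ZMod 2
  | 0, v => if I.image v = Finset.range I.card then 1 else 0
  | n + 1, v => ∑ i ∈ I, if v i = 0 then 0 else pathPar I n (Function.update v i (v i - 1))

lemma pathPar_congr {I : Finset ℕ} (n : ℕ) {v w : ℕ → ℕ} (h : ∀ i ∈ I, v i = w i) :
    pathPar I n v = pathPar I n w := by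
  induction n generalizing v w with
  | zero => simp only [pathPar, Finset.image_congr (fun i hi => h i hi)]
  | succ n ih =>
    simp only [pathPar]
    refine Finset.sum_congr rfl fun i hi => ?_
    rw [h i hi]
    split_ifs with h0
    · rfl
    · refine ih fun l hl => ?_
      by_cases hli : l = i
      · subst hli; simp
      · simp [hli, h l hl]

lemma pathPar_image {I : Finset ℕ} (n : ℕ) {σ : ℕ → ℕ} (hσ : Set.InjOn σ I) (v : ℕ → ℕ) :
    pathPar (I.image σ) n v = pathPar I n (v ∘ σ) := by
  induction n generalizing v with
  | zero => simp only [pathPar, Finset.image_image, Finset.card_image_of_injOn hσ]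
  | succ n ih =>
    simp only [pathPar]
    rw [Finset.sum_image hσ]
    refine Finset.sum_congr rfl fun i hi => ?_
    simp only [Function.comp]
    split_ifs with h0
    · rfl
    · rw [ih]
      refine pathPar_congr n fun l hl => ?_
      by_cases hli : l = i
      · subst hli; simp
      · have : σ l ≠ σ i := fun h => hli (hσ hl hi h)
        simp [hli, this]

lemma pathPar_comp_swap {I : Finset ℕ} (n : ℕ) {i j : ℕ} (hi : i ∈ I) (hj : j ∈ I) (v : ℕ → ℕ) :
    pathPar I n (v ∘ Equiv.swap i j) = pathPar I n v := by
  have hI : I.image (Equiv.swap i j) = I := by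
    refine Finset.eq_of_subset_of_card_le ?_ ?_
    · intro x hx
      obtain ⟨y, hy, rfl⟩ := Finset.mem_image.1 hx
      by_cases h1 : y = i
      · subst h1; simpa using hj
      by_cases h2 : y = j
      · subst h2; simpa using hi
      rwa [Equiv.swap_apply_of_ne_of_ne h1 h2]
    · rw [Finset.card_image_of_injective _ (Equiv.swap i j).injective]
  rw [← pathPar_image n (Equiv.swap i j).injective.injOn, hI]

lemma zmod_two_add_self (x : ZMod 2) : x + x = 0 := CharTwo.add_self_eq_zero x

lemma pathPar_eq_zero_of_eq {I : Finset ℕ} (n : ℕ) {v : ℕ → ℕ} {i j : ℕ} (hi : i ∈ I) (hj : j ∈ I)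
    (hij : i ≠ j) (h : v i = v j) : pathPar I n v = 0 := by
  induction n generalizing v with
  | zero =>
    simp only [pathPar]
    rw [if_neg]
    intro hc
    have h1 : (I.image v).card = I.card := by rw [hc, Finset.card_range]
    exact hij (Finset.card_image_iff.1 h1 hi hj h)
  | succ n ih =>
    simp only [pathPar]
    rw [← Finset.add_sum_erase I _ hi, ← Finset.add_sum_erase (I.erase i) _
      (Finset.mem_erase.2 ⟨hij.symm, hj⟩), ← add_assoc]
    have hrest : ∀ l ∈ (I.erase i).erase j,
        (if v l = 0 then 0 else pathPar I n (Function.update v l (v l - 1))) = 0 := by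
      intro l hl
      simp only [Finset.mem_erase] at hl
      split_ifs
      · rfl
      · apply ih
        rw [Function.update_of_ne (Ne.symm hl.2.1), Function.update_of_ne (Ne.symm hl.1), h]
    rw [Finset.sum_eq_zero hrest, add_zero, h]
    have hsw : Function.update v i (v j - 1) =
        Function.update v j (v j - 1) ∘ Equiv.swap i j := by
      funext l
      by_cases h1 : l = i
      · subst h1; simp
      by_cases h2 : l = j
      · subst h2; simp [hij, h, Ne.symm hij]
      · simp [h1, h2, Equiv.swap_apply_of_ne_of_ne h1 h2]
    rw [hsw, pathPar_comp_swap n hi hj]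
    exact zmod_two_add_self _

lemma pathPar_add_two (I : Finset ℕ) (n : ℕ) (v : ℕ → ℕ) :
    pathPar I (n + 2) v =
      ∑ i ∈ I, if v i < 2 then 0 else pathPar I n (Function.update v i (v i - 2)) := by
  simp only [pathPar]
  let g : ℕ → ℕ → ZMod 2 := fun i j => if v i = 0 then 0 else
    if Function.update v i (v i - 1) j = 0 then 0 else
      pathPar I n (Function.update (Function.update v i (v i - 1)) j
        (Function.update v i (v i - 1) j - 1))
  have hsymm : ∀ i j, i ≠ j → g i j = g j i := by
    intro i j hij
    simp only [g, Function.update_of_ne hij, Function.update_of_ne hij.symm]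
    rw [Function.update_comm hij]
    split_ifs <;> rfl
  have hdiag : ∀ i, g i i = if v i < 2 then 0 else
      pathPar I n (Function.update v i (v i - 2)) := by
    intro i
    simp only [g, Function.update_self, Function.update_idem]
    by_cases h0 : v i = 0
    · simp [h0]
    by_cases h1 : v i < 2
    · have : v i - 1 = 0 := by omega
      simp [h1, this]
    · have : v i - 1 ≠ 0 := by omega
      rw [if_neg h0, if_neg this, if_neg h1, Nat.sub_sub]
  have hlhs : (∑ i ∈ I, if v i = 0 then 0 else
      ∑ j ∈ I, if Function.update v i (v i - 1) j = 0 then 0 else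
      pathPar I n (Function.update (Function.update v i (v i - 1)) j
        (Function.update v i (v i - 1) j - 1))) = ∑ p ∈ I ×ˢ I, g p.1 p.2 := by
    rw [Finset.sum_product]
    refine Finset.sum_congr rfl fun i _ => ?_
    simp only [g]
    split_ifs
    · simp
    · rfl
  rw [hlhs, ← Finset.diag_union_offDiag, Finset.sum_union (Finset.disjoint_diag_offDiag I)]
  have hoff : ∑ p ∈ I.offDiag, g p.1 p.2 = 0 := by
    refine Finset.sum_involution (fun p _ => (p.2, p.1)) ?_ ?_ ?_ ?_
    · rintro ⟨i, j⟩ hp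
      rw [Finset.mem_offDiag] at hp
      simp only
      rw [hsymm i j hp.2.2]
      exact zmod_two_add_self _
    · rintro ⟨i, j⟩ hp _ heq
      rw [Finset.mem_offDiag] at hp
      exact hp.2.2 (Prod.mk.inj heq).2
    · rintro ⟨i, j⟩ hp
      rw [Finset.mem_offDiag] at hp ⊢
      exact ⟨hp.2.1, hp.1, hp.2.2.symm⟩
    · rintro ⟨i, j⟩ _
      rfl
  rw [hoff, add_zero, Finset.sum_diag]
  exact Finset.sum_congr rfl fun i _ => hdiag i

lemma sum_eq_of_pathPar_ne_zero {I : Finset ℕ} {n : ℕ} {v : ℕ → ℕ} (h : pathPar I n v ≠ 0) :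
    ∑ i ∈ I, v i = n + ∑ i ∈ Finset.range I.card, i := by
  induction n generalizing v with
  | zero =>
    simp only [pathPar, ne_eq, ite_eq_right_iff, Classical.not_imp] at h
    have h1 : (I.image v).card = I.card := by rw [h.1, Finset.card_range]
    rw [← h.1, Finset.sum_image (Finset.card_image_iff.1 h1), zero_add]
  | succ n ih =>
    simp only [pathPar] at h
    obtain ⟨i, hi, hne⟩ := Finset.exists_ne_zero_of_sum_ne_zero h
    split_ifs at hne with h0
    · exact absurd rfl hne
    have := ih hne
    rw [Finset.sum_update_of_mem hi] at this
    rw [← Finset.add_sum_erase I v hi]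
    rw [Finset.sdiff_singleton_eq_erase] at this
    omega

/-! ### Bead sets and partitions -/

lemma card_filter_lt_le (S : Finset ℕ) (b : ℕ) : (S.filter (fun a => a < b)).card ≤ b := by
  have h : S.filter (fun a => a < b) ⊆ Finset.range b := fun x hx => by
    simpa using (Finset.mem_filter.1 hx).2
  simpa using Finset.card_le_card h

lemma card_filter_lt_le_add (S : Finset ℕ) (a b : ℕ) :
    (S.filter (fun x => x < b)).card ≤ (S.filter (fun x => x < a)).card + (b - a) := by
  have h : S.filter (fun x => x < b) ⊆ S.filter (fun x => x < a) ∪ Finset.Ico a b := by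
    intro x hx
    simp only [Finset.mem_union, Finset.mem_filter, Finset.mem_Ico] at hx ⊢
    by_cases h : x < a
    · exact Or.inl ⟨hx.1, h⟩
    · exact Or.inr ⟨by omega, hx.2⟩
  calc _ ≤ _ := Finset.card_le_card h
    _ ≤ _ := Finset.card_union_le _ _
    _ = _ := by simp

/-- The number of gaps below the position `b`. -/
def gaps (S : Finset ℕ) (b : ℕ) : ℕ := b - (S.filter (fun a => a < b)).card

lemma gaps_mono (S : Finset ℕ) {a b : ℕ} (hab : a ≤ b) : gaps S a ≤ gaps S b := by
  have h1 := card_filter_lt_le S a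
  have h2 := card_filter_lt_le_add S a b
  unfold gaps
  omega

lemma partOfBeta_eq (S : Finset ℕ) :
    partOfBeta S = (S.val.map (gaps S)).filter (fun p => 0 < p) := rfl

lemma pos_of_mem_partOfBeta {S : Finset ℕ} {p : ℕ} (hp : p ∈ partOfBeta S) : 0 < p :=
  (Multiset.mem_filter.1 hp).2

lemma card_partOfBeta_le (S : Finset ℕ) : Multiset.card (partOfBeta S) ≤ S.card := by
  rw [partOfBeta_eq]
  exact (Multiset.card_le_card (Multiset.filter_le _ _)).trans (by simp)

lemma gaps_insert_of_lt {S : Finset ℕ} {a : ℕ} (h : ∀ x ∈ S, x < a) :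
    gaps (insert a S) a = a - S.card := by
  unfold gaps
  rw [Finset.filter_insert, if_neg (lt_irrefl a), Finset.filter_true_of_mem h]

lemma card_le_of_forall_lt {S : Finset ℕ} {a : ℕ} (h : ∀ x ∈ S, x < a) : S.card ≤ a := by
  have := card_filter_lt_le S a
  rwa [Finset.filter_true_of_mem h] at this

lemma partOfBeta_insert_max {S : Finset ℕ} {a : ℕ} (h : ∀ x ∈ S, x < a) :
    partOfBeta (insert a S) = (if 0 < a - S.card then {a - S.card} else 0) + partOfBeta S := by
  have ha : a ∉ S := fun h' => lt_irrefl a (h a h')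
  rw [partOfBeta_eq, partOfBeta_eq, Finset.insert_val_of_notMem ha, Multiset.map_cons,
    Multiset.filter_cons, gaps_insert_of_lt h]
  congr 2
  refine Multiset.map_congr rfl fun x hx => ?_
  unfold gaps
  rw [Finset.filter_insert, if_neg (by have := h x hx; omega)]

/-- The size of the partition encoded by a bead set. -/
def weight (S : Finset ℕ) : ℕ := (partOfBeta S).sum

lemma weight_insert_max {S : Finset ℕ} {a : ℕ} (h : ∀ x ∈ S, x < a) :
    weight (insert a S) = (a - S.card) + weight S := by
  unfold weight
  rw [partOfBeta_insert_max h, Multiset.sum_add]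
  split_ifs with h0
  · simp
  · simp only [Multiset.sum_zero]; omega

lemma weight_add_sum_range (S : Finset ℕ) :
    weight S + ∑ i ∈ Finset.range S.card, i = ∑ x ∈ S, x := by
  induction S using Finset.induction_on_max with
  | empty => simp [weight, partOfBeta]
  | insert a S h ih =>
    have ha : a ∉ S := fun h' => lt_irrefl a (h a h')
    have hc := card_le_of_forall_lt h
    rw [weight_insert_max h, Finset.card_insert_of_notMem ha, Finset.sum_range_succ,
      Finset.sum_insert ha]
    omega

lemma two_mul_weight (S : Finset ℕ) :
    2 * (weight S : ℤ) + S.card * (S.card - 1) = 2 * ∑ x ∈ S, (x : ℤ) := by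
  have h := weight_add_sum_range S
  have h2 : ∀ m : ℕ, 2 * ((∑ i ∈ Finset.range m, i : ℕ) : ℤ) = m * (m - 1) := by
    intro m
    induction m with
    | zero => simp
    | succ m ih => rw [Finset.sum_range_succ]; push_cast at ih ⊢; linarith
  have h3 := h2 S.card
  have h4 : ((weight S + ∑ i ∈ Finset.range S.card, i : ℕ) : ℤ) = ∑ x ∈ S, (x : ℤ) := by
    rw [h]; push_cast; rfl
  push_cast at h3 h4
  linarith

lemma partOfBeta_injective {S T : Finset ℕ} (hc : S.card = T.card)
    (h : partOfBeta S = partOfBeta T) : S = T := by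
  induction S using Finset.induction_on_max generalizing T with
  | empty => exact (Finset.card_eq_zero.1 (by simpa using hc.symm)).symm
  | insert a S hS ih =>
    have ha : a ∉ S := fun h' => lt_irrefl a (hS a h')
    rw [Finset.card_insert_of_notMem ha] at hc
    have hT : T.Nonempty := Finset.card_pos.1 (by omega)
    obtain ⟨b, T', hb, rfl⟩ : ∃ b T', (∀ x ∈ T', x < b) ∧ insert b T' = T := by
      refine ⟨T.max' hT, T.erase (T.max' hT), fun x hx => ?_,
        Finset.insert_erase (T.max'_mem hT)⟩
      exact Finset.lt_max'_of_mem_erase_max' T hT hx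
    have hb' : b ∉ T' := fun h' => lt_irrefl b (hb b h')
    rw [Finset.card_insert_of_notMem hb'] at hc
    have hc' : S.card = T'.card := by omega
    have key : ∀ {U V : Finset ℕ} {c d : ℕ}, (∀ x ∈ U, x < c) → (∀ x ∈ V, x < d) →
        partOfBeta (insert c U) = partOfBeta (insert d V) → c - U.card ≤ d - V.card := by
      intro U V c d hU hV he
      by_contra hlt
      have hm : c - U.card ∈ partOfBeta (insert c U) := by
        rw [partOfBeta_insert_max hU, if_pos (by omega)]
        simp
      rw [he, partOfBeta_eq, Multiset.mem_filter, Multiset.mem_map] at hm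
      obtain ⟨⟨x, hx, hxe⟩, _⟩ := hm
      have hxd : x ≤ d := by
        rcases Finset.mem_insert.1 (Finset.mem_def.2 hx) with rfl | hx
        · exact le_rfl
        · exact (hV x hx).le
      have := gaps_mono (insert d V) hxd
      rw [gaps_insert_of_lt hV] at this
      omega
    have h1 := key hS hb h
    have h2 := key hb hS h.symm
    have hca := card_le_of_forall_lt hS
    have hcb := card_le_of_forall_lt hb
    have hab : a = b := by omega
    subst hab
    rw [partOfBeta_insert_max hS, partOfBeta_insert_max hb, hc'] at h
    rw [ih hc' (add_left_cancel h)]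

lemma partOfBeta_range (m : ℕ) : partOfBeta (Finset.range m) = 0 := by
  induction m with
  | zero => simp [partOfBeta]
  | succ m ih =>
    rw [Finset.range_add_one, partOfBeta_insert_max (by simp), ih]
    simp

lemma weight_eq_zero_iff {S : Finset ℕ} : weight S = 0 ↔ S = Finset.range S.card := by
  constructor
  · intro h
    apply partOfBeta_injective (by simp)
    rw [partOfBeta_range]
    refine Multiset.eq_zero_of_forall_notMem fun p hp => ?_
    have h1 := pos_of_mem_partOfBeta hp
    have h2 := Multiset.le_sum_of_mem hp
    unfold weight at h
    omega
  · intro h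
    rw [h]
    simp [weight, partOfBeta_range]

/-- Add a bead at the bottom. -/
def shift (S : Finset ℕ) : Finset ℕ := insert 0 (S.image Nat.succ)

lemma mem_shift {S : Finset ℕ} {x : ℕ} : x ∈ shift S ↔ x = 0 ∨ (0 < x ∧ x - 1 ∈ S) := by
  unfold shift
  simp only [Finset.mem_insert, Finset.mem_image]
  constructor
  · rintro (h | ⟨y, hy, rfl⟩)
    · exact Or.inl h
    · exact Or.inr ⟨by omega, by simpa using hy⟩
  · rintro (h | ⟨h, h'⟩)
    · exact Or.inl h
    · exact Or.inr ⟨x - 1, h', by omega⟩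

lemma card_shift (S : Finset ℕ) : (shift S).card = S.card + 1 := by
  unfold shift
  rw [Finset.card_insert_of_notMem (by simp), Finset.card_image_of_injective _ Nat.succ_injective]

lemma shift_insert_of_lt {S : Finset ℕ} (a : ℕ) :
    shift (insert a S) = insert (a + 1) (shift S) := by
  unfold shift
  rw [Finset.image_insert, Finset.insert_comm]

lemma partOfBeta_shift (S : Finset ℕ) : partOfBeta (shift S) = partOfBeta S := by
  induction S using Finset.induction_on_max with
  | empty =>
    have : shift ∅ = Finset.range 1 := by simp [shift]
    rw [this, partOfBeta_range]; simp [partOfBeta]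
  | insert a S h ih =>
    rw [shift_insert_of_lt, partOfBeta_insert_max h, partOfBeta_insert_max, ih, card_shift]
    · simp
    · intro x hx
      rcases mem_shift.1 hx with rfl | ⟨h1, h2⟩
      · omega
      · have := h _ h2; omega

lemma descList_coe (lam : Multiset ℕ) : (descList lam : Multiset ℕ) = lam := by
  unfold descList
  rw [Multiset.coe_reverse, Multiset.sort_eq]

lemma length_descList (lam : Multiset ℕ) : (descList lam).length = Multiset.card lam := by
  conv_rhs => rw [← descList_coe lam]
  simp

lemma descList_getD_anti (lam : Multiset ℕ) {i j : ℕ} (hij : i ≤ j) :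
    (descList lam).getD j 0 ≤ (descList lam).getD i 0 := by
  have hp : (descList lam).Pairwise (· ≥ ·) := by
    unfold descList
    rw [List.pairwise_reverse]
    exact Multiset.pairwise_sort _ _
  rcases lt_or_ge j (descList lam).length with hj | hj
  · have hi : i < (descList lam).length := by omega
    rw [List.getD_eq_getElem _ _ hj, List.getD_eq_getElem _ _ hi]
    rcases hij.eq_or_lt with rfl | hlt
    · exact le_rfl
    · exact List.pairwise_iff_getElem.1 hp i j hi hj hlt
  · rw [List.getD_eq_default _ _ hj]
    exact Nat.zero_le _

lemma betaSet_lt (lam : Multiset ℕ) {m i j : ℕ} (hij : i < j) (hj : j < m) :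
    (descList lam).getD j 0 + (m - 1 - j) < (descList lam).getD i 0 + (m - 1 - i) := by
  have := descList_getD_anti lam hij.le
  omega

lemma betaSet_injOn (lam : Multiset ℕ) (m : ℕ) :
    Set.InjOn (fun i => (descList lam).getD i 0 + (m - 1 - i)) (Finset.range m) := by
  intro i hi j hj h
  simp only [Finset.coe_range, Set.mem_Iio] at hi hj
  simp only at h
  rcases lt_trichotomy i j with hlt | rfl | hlt
  · have := betaSet_lt lam hlt hj; omega
  · rfl
  · have := betaSet_lt lam hlt hi; omega

lemma card_betaSet (lam : Multiset ℕ) (m : ℕ) : (betaSet lam m).card = m := by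
  unfold betaSet
  rw [Finset.card_image_of_injOn (betaSet_injOn lam m), Finset.card_range]

lemma gaps_betaSet (lam : Multiset ℕ) {m i : ℕ} (hi : i < m) :
    gaps (betaSet lam m) ((descList lam).getD i 0 + (m - 1 - i)) = (descList lam).getD i 0 := by
  have : (betaSet lam m).filter (fun a => a < (descList lam).getD i 0 + (m - 1 - i)) =
      (Finset.Ico (i + 1) m).image (fun i => (descList lam).getD i 0 + (m - 1 - i)) := by
    ext x
    simp only [betaSet, Finset.mem_filter, Finset.mem_image, Finset.mem_range, Finset.mem_Ico]
    constructor
    · rintro ⟨⟨j, hj, rfl⟩, hlt⟩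
      refine ⟨j, ⟨?_, hj⟩, rfl⟩
      by_contra hle
      rcases (show j ≤ i by omega).eq_or_lt with rfl | h
      · omega
      · have := betaSet_lt lam h hi; omega
    · rintro ⟨j, ⟨h1, h2⟩, rfl⟩
      exact ⟨⟨j, h2, rfl⟩, betaSet_lt lam h1 h2⟩
  unfold gaps
  rw [this, Finset.card_image_of_injOn, Nat.card_Ico]
  · omega
  · exact (betaSet_injOn lam m).mono fun x hx => by
      simp only [Finset.coe_Ico, Set.mem_Ico] at hx
      simpa using hx.2

lemma partOfBeta_betaSet {lam : Multiset ℕ} (hpos : ∀ x ∈ lam, 0 < x) {m : ℕ}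
    (hm : Multiset.card lam ≤ m) : partOfBeta (betaSet lam m) = lam := by
  have h1 : (betaSet lam m).val.map (gaps (betaSet lam m)) =
      (Multiset.range m).map (fun i => (descList lam).getD i 0) := by
    conv_lhs =>
      arg 2
      rw [betaSet, Finset.image_val_of_injOn (betaSet_injOn lam m)]
    rw [Multiset.map_map]
    exact Multiset.map_congr rfl fun i hi => gaps_betaSet lam (Multiset.mem_range.1 hi)
  have h2 : (List.range m).map (fun i => (descList lam).getD i 0) =
      descList lam ++ List.replicate (m - (descList lam).length) 0 := by
    have hl := length_descList lam
    refine List.ext_getElem (by simp; omega) fun i hi _ => ?_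
    simp only [List.getElem_map, List.getElem_range, List.getElem_append]
    split_ifs with h
    · rw [List.getD_eq_getElem _ _ h]
    · rw [List.getD_eq_default _ _ (by omega)]; simp
  rw [partOfBeta_eq, h1, ← Multiset.coe_range, Multiset.map_coe, h2, ← Multiset.coe_add,
    descList_coe, Multiset.filter_add, Multiset.filter_eq_self.2 hpos]
  have : Multiset.filter (fun p => 0 < p)
      ((List.replicate (m - (descList lam).length) 0 : List ℕ) : Multiset ℕ) = 0 := by
    rw [Multiset.filter_eq_nil]
    intro a ha
    simp only [Multiset.mem_coe, List.mem_replicate] at ha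
    omega
  rw [this, add_zero]

lemma betaSet_partOfBeta (S : Finset ℕ) : betaSet (partOfBeta S) S.card = S :=
  partOfBeta_injective (card_betaSet _ _)
    (partOfBeta_betaSet (fun _ => pos_of_mem_partOfBeta) (card_partOfBeta_le S))

lemma betaSet_succ {lam : Multiset ℕ} (hpos : ∀ x ∈ lam, 0 < x) {m : ℕ}
    (hm : Multiset.card lam ≤ m) : betaSet lam (m + 1) = shift (betaSet lam m) := by
  refine partOfBeta_injective (by rw [card_shift, card_betaSet, card_betaSet]) ?_
  rw [partOfBeta_shift, partOfBeta_betaSet hpos hm, partOfBeta_betaSet hpos (by omega)]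

/-! ### Degrees and bead moves -/

/-- Move the bead `x` down by `e`. -/
def move (e : ℕ) (S : Finset ℕ) (x : ℕ) : Finset ℕ := insert (x - e) (S.erase x)

lemma card_move {e : ℕ} {S : Finset ℕ} {x : ℕ} (hx : x ∈ S) (hxe : x - e ∉ S) :
    (move e S x).card = S.card := by
  unfold move
  rw [Finset.card_insert_of_notMem fun h => hxe (Finset.mem_of_mem_erase h),
    Finset.card_erase_add_one hx]

lemma weight_move {e : ℕ} {S : Finset ℕ} {x : ℕ} (hx : x ∈ S) (hex : e ≤ x) (hxe : x - e ∉ S) :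
    weight (move e S x) + e = weight S := by
  have h1 := weight_add_sum_range S
  have h2 := weight_add_sum_range (move e S x)
  rw [card_move hx hxe] at h2
  have h3 := Finset.add_sum_erase S (fun x => x) hx
  have h4 : ∑ y ∈ move e S x, y = (x - e) + ∑ y ∈ S.erase x, y := by
    unfold move
    rw [Finset.sum_insert fun h => hxe (Finset.mem_of_mem_erase h)]
  omega

lemma gaps_eq_of_pred_notMem {S : Finset ℕ} {x : ℕ} (h0 : x ≠ 0) (hx : x - 1 ∉ S) :
    gaps S x = gaps S (x - 1) + 1 := by
  have h : S.filter (fun a => a < x) = S.filter (fun a => a < x - 1) := by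
    ext y
    simp only [Finset.mem_filter, and_congr_right_iff]
    intro hy
    have : y ≠ x - 1 := fun h => hx (h ▸ hy)
    omega
  have := card_filter_lt_le S (x - 1)
  unfold gaps
  rw [h]
  omega

lemma gaps_eq_of_pred_mem {S : Finset ℕ} {x : ℕ} (h0 : x ≠ 0) (hx : x - 1 ∈ S) :
    gaps S x = gaps S (x - 1) := by
  have h : S.filter (fun a => a < x) = insert (x - 1) (S.filter (fun a => a < x - 1)) := by
    ext y
    simp only [Finset.mem_filter, Finset.mem_insert]
    constructor
    · rintro ⟨h1, h2⟩
      by_cases h : y = x - 1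
      · exact Or.inl h
      · exact Or.inr ⟨h1, by omega⟩
    · rintro (rfl | ⟨h1, h2⟩)
      · exact ⟨hx, by omega⟩
      · exact ⟨h1, by omega⟩
  unfold gaps
  rw [h, Finset.card_insert_of_notMem (by simp)]
  omega

lemma removeBox_partOfBeta {S : Finset ℕ} {x : ℕ} (hx : x ∈ S) (h0 : x ≠ 0) (hx1 : x - 1 ∉ S) :
    removeBox (partOfBeta S) (gaps S x) = partOfBeta (move 1 S x) := by
  have hne : x - 1 ∉ S.erase x := fun h => hx1 (Finset.mem_of_mem_erase h)
  have hg := gaps_eq_of_pred_notMem h0 hx1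
  have hfirst : gaps (move 1 S x) (x - 1) = gaps S (x - 1) := by
    unfold gaps move
    rw [Finset.filter_insert, if_neg (lt_irrefl _), Finset.filter_erase,
      Finset.erase_eq_of_notMem]
    simp
  have hrest : ∀ y ∈ S.erase x, gaps (move 1 S x) y = gaps S y := by
    intro y hy
    have hyx := Finset.ne_of_mem_erase hy
    have hyx1 : y ≠ x - 1 := fun h => hne (h ▸ hy)
    unfold gaps move
    by_cases hlt : x < y
    · rw [Finset.filter_insert, if_pos (by omega), Finset.filter_erase,
        Finset.card_insert_of_notMem (by simp [hx1]),
        Finset.card_erase_add_one (by simp [hx, hlt])]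
    · rw [Finset.filter_insert, if_neg (by omega), Finset.filter_erase,
        Finset.erase_eq_of_notMem (by simp [hlt])]
  set M := ((S.erase x).val.map (gaps S)).filter (fun p => 0 < p) with hM
  have h1 : partOfBeta S = gaps S x ::ₘ M := by
    conv_lhs => rw [partOfBeta_eq]
    conv_lhs =>
      arg 2
      arg 2
      rw [← Finset.insert_erase hx]
    rw [Finset.insert_val_of_notMem (Finset.notMem_erase x S), Multiset.map_cons,
      Multiset.filter_cons_of_pos _ (by omega)]
  have h2 : partOfBeta (move 1 S x) = (if 0 < gaps S (x - 1) then {gaps S (x - 1)} else 0) + M := by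
    rw [partOfBeta_eq]
    conv_lhs =>
      arg 2
      arg 2
      rw [move]
    rw [Finset.insert_val_of_notMem hne, Multiset.map_cons, Multiset.filter_cons, hfirst, hM]
    congr 2
    exact Multiset.map_congr rfl fun y hy => hrest y hy
  rw [h2, h1, removeBox, Multiset.erase_cons_head]
  by_cases h : gaps S (x - 1) = 0
  · rw [if_pos (by omega), if_neg (by omega), zero_add]
  · rw [if_neg (by omega), if_pos (by omega), Multiset.singleton_add, hg, Nat.add_sub_cancel]

lemma pathPar_succ_id (S : Finset ℕ) (n : ℕ) :
    pathPar S (n + 1) id =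
      ∑ x ∈ S.filter (fun x => x ≠ 0 ∧ x - 1 ∉ S), pathPar (move 1 S x) n id := by
  simp only [pathPar]
  rw [Finset.sum_filter]
  refine Finset.sum_congr rfl fun x hx => ?_
  by_cases h0 : x = 0
  · simp [h0]
  by_cases h1 : x - 1 ∈ S
  · rw [if_neg (show ¬id x = 0 from h0), if_neg fun h => h.2 h1]
    refine pathPar_eq_zero_of_eq n hx h1 (by omega) ?_
    rw [Function.update_self, Function.update_of_ne (by omega)]
    rfl
  · rw [if_neg (show ¬id x = 0 from h0), if_pos ⟨h0, h1⟩]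
    have hinj : Set.InjOn (Function.update id x (x - 1)) (S : Set ℕ) := by
      intro a ha b hb hab
      by_cases hax : a = x <;> by_cases hbx : b = x
      · rw [hax, hbx]
      · subst hax
        simp only [Function.update_self, Function.update_of_ne hbx, id] at hab
        exact absurd (hab ▸ hb) h1
      · subst hbx
        simp only [Function.update_self, Function.update_of_ne hax, id] at hab
        exact absurd (hab ▸ ha) h1
      · simpa [hax, hbx] using hab
    have himg : S.image (Function.update id x (x - 1)) = move 1 S x := by
      rw [← Finset.insert_erase hx, Finset.image_insert, Function.update_self]
      unfold move
      rw [Finset.insert_erase hx]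
      congr 1
      rw [Finset.image_congr (g := id), Finset.image_id]
      intro y hy
      rw [Function.update_of_ne (Finset.ne_of_mem_erase hy)]
    rw [← himg, pathPar_image n hinj]
    rfl

lemma degSYT_partOfBeta (S : Finset ℕ) :
    (degSYT (partOfBeta S) : ZMod 2) = pathPar S (weight S) id := by
  induction hn : weight S generalizing S with
  | zero =>
    have h := weight_eq_zero_iff.1 hn
    rw [h, partOfBeta_range, degSYT]
    simp [pathPar]
  | succ n ih =>
    have hne : partOfBeta S ≠ 0 := by
      intro h
      unfold weight at hn
      rw [h] at hn
      simp at hn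
    rw [degSYT, dif_neg hne, pathPar_succ_id,
      Finset.sum_attach ((partOfBeta S).toFinset.filter (fun p => 0 < p))
        (fun p => degSYT (removeBox (partOfBeta S) p)), Nat.cast_sum]
    symm
    refine Finset.sum_bij (fun x _ => gaps S x) ?_ ?_ ?_ ?_
    · intro x hx
      obtain ⟨hx, h0, h1⟩ := Finset.mem_filter.1 hx
      have := gaps_eq_of_pred_notMem h0 h1
      simp only [Finset.mem_filter, Multiset.mem_toFinset, partOfBeta_eq, Multiset.mem_filter,
        Multiset.mem_map]
      exact ⟨⟨⟨x, hx, rfl⟩, by omega⟩, by omega⟩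
    · have key : ∀ x y, x < y → y - 1 ∉ S → gaps S x ≠ gaps S y := by
        intro x y hxy hy
        have h1 := gaps_eq_of_pred_notMem (by omega) hy
        have h2 := gaps_mono S (show x ≤ y - 1 by omega)
        omega
      intro x hx y hy hxy
      rcases lt_trichotomy x y with h | h | h
      · exact absurd hxy (key x y h (Finset.mem_filter.1 hy).2.2)
      · exact h
      · exact absurd hxy.symm (key y x h (Finset.mem_filter.1 hx).2.2)
    · have key : ∀ b, b ∈ S → 0 < gaps S b →
          ∃ x, x ∈ S ∧ x ≠ 0 ∧ x - 1 ∉ S ∧ gaps S x = gaps S b := by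
        intro b
        induction b with
        | zero => intro _ h; simp [gaps] at h
        | succ b ihb =>
          intro hb hpos
          by_cases h : b ∈ S
          · have he := gaps_eq_of_pred_mem (x := b + 1) (by omega) h
            rw [Nat.add_sub_cancel] at he
            rw [he] at hpos ⊢
            exact ihb h hpos
          · exact ⟨b + 1, hb, by omega, h, rfl⟩
      intro p hp
      simp only [Finset.mem_filter, Multiset.mem_toFinset, partOfBeta_eq, Multiset.mem_filter,
        Multiset.mem_map] at hp
      obtain ⟨⟨⟨b, hb, rfl⟩, hpos⟩, _⟩ := hp
      obtain ⟨x, h1, h2, h3, h4⟩ := key b hb hpos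
      exact ⟨x, Finset.mem_filter.2 ⟨h1, h2, h3⟩, h4⟩
    · intro x hx
      obtain ⟨hx, h0, h1⟩ := Finset.mem_filter.1 hx
      have hw := weight_move hx (by omega) h1
      rw [removeBox_partOfBeta hx h0 h1, ih _ (by omega)]

lemma pathPar_id_eq_zero {S : Finset ℕ} {n : ℕ} (h : weight S ≠ n) : pathPar S n id = 0 := by
  by_contra hne
  have h1 := sum_eq_of_pathPar_ne_zero hne
  have h2 := weight_add_sum_range S
  simp only [id] at h1
  omega

lemma pathPar_id_of_le_one {S : Finset ℕ} {n : ℕ} (hn : n ≤ 1) :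
    pathPar S n id = if weight S = n then 1 else 0 := by
  split_ifs with h
  · rw [← h, ← degSYT_partOfBeta]
    rcases (show n = 0 ∨ n = 1 by omega) with rfl | rfl
    · rw [weight_eq_zero_iff.1 h, partOfBeta_range, degSYT]
      simp
    · have h1 : partOfBeta S = {1} := by
        have hne : partOfBeta S ≠ 0 := by
          intro h'
          unfold weight at h
          rw [h'] at h
          simp at h
        obtain ⟨p, hp⟩ := Multiset.exists_mem_of_ne_zero hne
        obtain ⟨M, hM⟩ := Multiset.exists_cons_of_mem hp
        have hp0 := pos_of_mem_partOfBeta hp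
        unfold weight at h
        rw [hM, Multiset.sum_cons] at h
        have hM0 : M = 0 := by
          refine Multiset.eq_zero_of_forall_notMem fun q hq => ?_
          have h1 := pos_of_mem_partOfBeta (S := S) (p := q) (by rw [hM]; simp [hq])
          have h2 := Multiset.le_sum_of_mem hq
          omega
        subst hM0
        rw [hM]
        simp at h
        simp [h]
      rw [h1, degSYT, dif_neg (by simp),
        Finset.sum_attach (({1} : Multiset ℕ).toFinset.filter (fun p => 0 < p))
          (fun p => degSYT (removeBox {1} p))]
      have : (({1} : Multiset ℕ).toFinset.filter (fun p => 0 < p)) = {1} := by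
        ext x; simp; omega
      rw [this, Finset.sum_singleton, removeBox, if_pos le_rfl, Multiset.erase_singleton, degSYT]
      simp
  · exact pathPar_id_eq_zero h

/-! ### The two runners of the abacus -/

/-- The runner of residue `r` of the two-runner abacus. -/
def half (r : ℕ) (S : Finset ℕ) : Finset ℕ := (S.filter (fun b => b % 2 = r)).image (fun b => b / 2)

lemma mem_half {r : ℕ} (hr : r < 2) {S : Finset ℕ} {y : ℕ} : y ∈ half r S ↔ 2 * y + r ∈ S := by
  unfold half
  simp only [Finset.mem_image, Finset.mem_filter]
  constructor
  · rintro ⟨x, ⟨hx, hxr⟩, rfl⟩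
    rwa [show 2 * (x / 2) + r = x by omega]
  · intro h
    exact ⟨2 * y + r, ⟨h, by omega⟩, by omega⟩

lemma half_injOn (r : ℕ) (S : Finset ℕ) :
    Set.InjOn (fun b => b / 2) (S.filter (fun b => b % 2 = r) : Finset ℕ) := by
  intro x hx y hy h
  have h1 := (Finset.mem_filter.1 hx).2
  have h2 := (Finset.mem_filter.1 hy).2
  simp only at h
  omega

lemma sum_half (S : Finset ℕ) (f : ℕ → ℕ) :
    ∑ x ∈ S, f x = ∑ y ∈ half 0 S, f (2 * y) + ∑ y ∈ half 1 S, f (2 * y + 1) := by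
  rw [← Finset.sum_filter_add_sum_filter_not S (fun b => b % 2 = 0)]
  unfold half
  rw [Finset.sum_image (half_injOn 0 S), Finset.sum_image (half_injOn 1 S)]
  congr 1
  · refine Finset.sum_congr rfl fun x hx => ?_
    have := (Finset.mem_filter.1 hx).2
    congr 1; omega
  · have : S.filter (fun b => ¬ b % 2 = 0) = S.filter (fun b => b % 2 = 1) :=
      Finset.filter_congr fun x _ => by omega
    rw [this]
    refine Finset.sum_congr rfl fun x hx => ?_
    have := (Finset.mem_filter.1 hx).2
    congr 1; omega

lemma card_half (S : Finset ℕ) : S.card = (half 0 S).card + (half 1 S).card := by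
  simpa using sum_half S (fun _ => 1)

/-- The difference between the numbers of beads on the two runners. -/
def charge (S : Finset ℕ) : ℤ := (half 0 S).card - (half 1 S).card

lemma two_mul_weight_half (S : Finset ℕ) :
    2 * (weight S : ℤ) =
      4 * (weight (half 0 S) + weight (half 1 S)) + charge S * (charge S - 1) := by
  have h := two_mul_weight S
  have h0 := two_mul_weight (half 0 S)
  have h1 := two_mul_weight (half 1 S)
  have hc : (S.card : ℤ) = (half 0 S).card + (half 1 S).card := by exact_mod_cast card_half S
  have hs : ∑ x ∈ S, (x : ℤ) =
      2 * ∑ x ∈ half 0 S, (x : ℤ) + (2 * ∑ x ∈ half 1 S, (x : ℤ) + (half 1 S).card) := by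
    have := congrArg (Nat.cast : ℕ → ℤ) (sum_half S (fun x => x))
    push_cast at this
    rw [this, Finset.sum_add_distrib, Finset.mul_sum, Finset.mul_sum]
    simp
  unfold charge
  rw [hc, hs] at h
  linarith

lemma pathPar_self_image {I : Finset ℕ} (n : ℕ) {v : ℕ → ℕ} (hv : Set.InjOn v I) :
    pathPar I n v = pathPar (I.image v) n id := by
  rw [pathPar_image n hv]
  rfl

lemma image_half {I : Finset ℕ} {v : ℕ → ℕ} (r : ℕ) :
    half r (I.image v) = (I.filter (fun i => v i % 2 = r)).image (fun i => v i / 2) := by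
  unfold half
  rw [Finset.filter_image, Finset.image_image]
  rfl

lemma half_image_injOn {I : Finset ℕ} {v : ℕ → ℕ} (hv : Set.InjOn v I) (r : ℕ) :
    Set.InjOn (fun i => v i / 2) (I.filter (fun i => v i % 2 = r) : Finset ℕ) := by
  intro i hi j hj h
  have h1 := Finset.mem_filter.1 hi
  have h2 := Finset.mem_filter.1 hj
  simp only at h
  exact hv h1.1 h2.1 (by omega)

lemma pathPar_split_base {I I0 I1 : Finset ℕ} {v : ℕ → ℕ} {e : ℕ} (he : e ≤ 1)
    (h0 : I0 = I.filter (fun i => v i % 2 = 0)) (h1 : I1 = I.filter (fun i => v i % 2 = 1)) :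
    pathPar I e v = if ((I0.card : ℤ) - I1.card) * (I0.card - I1.card - 1) = 2 * e then
      pathPar I0 0 (fun i => v i / 2) * pathPar I1 0 (fun i => v i / 2) else 0 := by
  by_cases hv : Set.InjOn v I
  · have i0 := half_image_injOn hv 0
    have i1 := half_image_injOn hv 1
    have c0 : (I0.card : ℤ) = (half 0 (I.image v)).card := by
      rw [image_half, Finset.card_image_of_injOn i0, h0]
    have c1 : (I1.card : ℤ) = (half 1 (I.image v)).card := by
      rw [image_half, Finset.card_image_of_injOn i1, h1]
    rw [c0, c1, h0, h1, pathPar_self_image _ hv, pathPar_self_image _ i0, pathPar_self_image _ i1,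
      ← image_half, ← image_half, pathPar_id_of_le_one he, pathPar_id_of_le_one zero_le_one,
      pathPar_id_of_le_one zero_le_one]
    have hw := two_mul_weight_half (I.image v)
    unfold charge at hw
    set d : ℤ := ((half 0 (I.image v)).card : ℤ) - (half 1 (I.image v)).card
    have hd : 0 ≤ d * (d - 1) := by
      rcases le_or_gt d 0 with h | h
      · nlinarith
      · nlinarith
    generalize d * (d - 1) = c at hw hd ⊢
    generalize weight (half 0 (I.image v)) = w0 at *
    generalize weight (half 1 (I.image v)) = w1 at *
    generalize weight (I.image v) = w at *
    by_cases hc : c = 2 * e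
    · by_cases hw0 : w0 = 0
      · by_cases hw1 : w1 = 0
        · rw [if_pos (by omega), if_pos hc, if_pos hw0, if_pos hw1, one_mul]
        · rw [if_neg (by omega), if_pos hc, if_neg hw1, mul_zero]
      · rw [if_neg (by omega), if_pos hc, if_neg hw0, zero_mul]
    · rw [if_neg (by omega), if_neg hc]
  · simp only [Set.InjOn, not_forall] at hv
    obtain ⟨i, hi, j, hj, hij, hne⟩ := hv
    rw [pathPar_eq_zero_of_eq e hi hj hne hij]
    symm
    rw [ite_eq_right_iff]
    intro _
    rcases Nat.mod_two_eq_zero_or_one (v i) with hm | hm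
    · rw [pathPar_eq_zero_of_eq (I := I0) (i := i) (j := j) 0 _ _ hne (by simp only [hij]),
        zero_mul]
      · rw [h0]; exact Finset.mem_filter.2 ⟨hi, hm⟩
      · rw [h0]; exact Finset.mem_filter.2 ⟨hj, hij ▸ hm⟩
    · rw [pathPar_eq_zero_of_eq (I := I1) (i := i) (j := j) 0 _ _ hne (by simp only [hij]),
        mul_zero]
      · rw [h1]; exact Finset.mem_filter.2 ⟨hi, hm⟩
      · rw [h1]; exact Finset.mem_filter.2 ⟨hj, hij ▸ hm⟩

lemma pathPar_split {I I0 I1 : Finset ℕ} {v : ℕ → ℕ} {e : ℕ} (w : ℕ) (he : e ≤ 1)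
    (h0 : I0 = I.filter (fun i => v i % 2 = 0)) (h1 : I1 = I.filter (fun i => v i % 2 = 1)) :
    pathPar I (2 * w + e) v = if ((I0.card : ℤ) - I1.card) * (I0.card - I1.card - 1) = 2 * e then
      ∑ p ∈ Finset.HasAntidiagonal.antidiagonal w, (w.choose p.1 : ZMod 2) *
        (pathPar I0 p.1 (fun i => v i / 2) * pathPar I1 p.2 (fun i => v i / 2)) else 0 := by
  induction w generalizing v with
  | zero =>
    rw [mul_zero, zero_add, pathPar_split_base he h0 h1]
    simp
  | succ w ih =>
    rw [show 2 * (w + 1) + e = (2 * w + e) + 2 by ring, pathPar_add_two]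
    have hupd : ∀ i, ¬ v i < 2 →
        (fun l => Function.update v i (v i - 2) l / 2) =
          Function.update (fun l => v l / 2) i (v i / 2 - 1) := by
      intro i hi
      funext l
      by_cases hl : l = i
      · subst hl; simp only [Function.update_self]; omega
      · simp [hl]
    have hpar : ∀ i r, ¬ v i < 2 → I.filter (fun l => Function.update v i (v i - 2) l % 2 = r) =
        I.filter (fun l => v l % 2 = r) := by
      intro i r hi
      refine Finset.filter_congr fun l _ => ?_
      by_cases hl : l = i
      · subst hl; simp only [Function.update_self]; omega
      · simp [hl]
    have hstep : ∀ i ∈ I, (if v i < 2 then 0 else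
        pathPar I (2 * w + e) (Function.update v i (v i - 2))) =
        if ((I0.card : ℤ) - I1.card) * (I0.card - I1.card - 1) = 2 * e then
          ∑ p ∈ Finset.HasAntidiagonal.antidiagonal w, (w.choose p.1 : ZMod 2) * (if v i / 2 = 0 then 0 else
          (pathPar I0 p.1 (Function.update (fun l => v l / 2) i (v i / 2 - 1)) *
            pathPar I1 p.2 (Function.update (fun l => v l / 2) i (v i / 2 - 1)))) else 0 := by
      intro i hi
      by_cases h2 : v i < 2
      · have : v i / 2 = 0 := by omega
        simp [h2, this]
      · have : ¬ v i / 2 = 0 := by omega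
        rw [if_neg h2, ih (h0.trans (hpar i 0 h2).symm) (h1.trans (hpar i 1 h2).symm), hupd i h2]
        simp only [if_neg this]
    rw [Finset.sum_congr rfl hstep]
    split_ifs with hc
    · rw [Finset.sum_comm, Finset.sum_antidiagonal_choose_succ_mul
        (fun a b => pathPar I0 a (fun i => v i / 2) * pathPar I1 b (fun i => v i / 2)),
        ← Finset.sum_add_distrib]
      refine Finset.sum_congr rfl fun p hp => ?_
      have hch : w.choose p.2 = w.choose p.1 :=
        (Nat.choose_symm_of_eq_add (Finset.HasAntidiagonal.mem_antidiagonal.1 hp).symm).symm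
      rw [hch, ← Finset.mul_sum, ← mul_add]
      congr 1
      rw [← Finset.sum_filter_add_sum_filter_not I (fun i => v i % 2 = 0)]
      have hI1 : I.filter (fun i => ¬ v i % 2 = 0) = I1 := by
        rw [h1]; exact Finset.filter_congr fun x _ => by omega
      rw [hI1, ← h0, add_comm]
      congr 1
      · simp only [pathPar]
        rw [Finset.mul_sum]
        refine Finset.sum_congr rfl fun i hi => ?_
        rw [mul_ite, mul_zero]
        split_ifs
        · rfl
        · congr 1
          refine pathPar_congr _ fun l hl => ?_
          rw [Function.update_of_ne]
          rintro rfl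
          rw [h1] at hi; rw [h0] at hl
          have := (Finset.mem_filter.1 hi).2
          have := (Finset.mem_filter.1 hl).2
          omega
      · simp only [pathPar]
        rw [Finset.sum_mul]
        refine Finset.sum_congr rfl fun i hi => ?_
        rw [ite_mul, zero_mul]
        split_ifs
        · rfl
        · congr 1
          refine pathPar_congr _ fun l hl => ?_
          rw [Function.update_of_ne]
          rintro rfl
          rw [h0] at hi; rw [h1] at hl
          have := (Finset.mem_filter.1 hi).2
          have := (Finset.mem_filter.1 hl).2
          omega
    · simp

/-- The bead set encodes an odd partition. -/
def OddBeads (S : Finset ℕ) : Prop := Odd (degSYT (partOfBeta S))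

lemma oddBeads_iff (S : Finset ℕ) : OddBeads S ↔ pathPar S (weight S) id ≠ 0 := by
  unfold OddBeads
  rw [← degSYT_partOfBeta, ← Nat.not_even_iff_odd, ne_eq, ZMod.natCast_eq_zero_iff_even]

lemma oddBeads_iff_half (S : Finset ℕ) :
    OddBeads S ↔ OddBeads (half 0 S) ∧ OddBeads (half 1 S) ∧
      Odd ((weight (half 0 S) + weight (half 1 S)).choose (weight (half 0 S))) ∧
      -1 ≤ charge S ∧ charge S ≤ 2 := by
  have hv : Set.InjOn (id : ℕ → ℕ) S := Function.injective_id.injOn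
  have hw := two_mul_weight_half S
  set w0 := weight (half 0 S) with hw0
  set w1 := weight (half 1 S) with hw1
  obtain ⟨w, e, he, hwe⟩ : ∃ w e, e ≤ 1 ∧ weight S = 2 * w + e :=
    ⟨weight S / 2, weight S % 2, by omega, by omega⟩
  have hsplit := pathPar_split (I := S) (v := id) (e := e) w he rfl rfl
  have e0 : ∀ r n, pathPar (S.filter (fun i => id i % 2 = r)) n (fun i => id i / 2) =
      pathPar (half r S) n id := by
    intro r n
    rw [pathPar_self_image n (half_image_injOn hv r)]
    rfl
  have ec : ∀ r, (S.filter (fun i => id i % 2 = r)).card = (half r S).card := by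
    intro r
    rw [half, Finset.card_image_of_injOn (half_injOn r S)]
    rfl
  rw [ec 0, ec 1] at hsplit
  simp only [e0] at hsplit
  rw [oddBeads_iff, oddBeads_iff, oddBeads_iff, hwe, hsplit]
  change (if charge S * (charge S - 1) = 2 * e then _ else _) ≠ 0 ↔ _
  by_cases hc : -1 ≤ charge S ∧ charge S ≤ 2
  · have hc2 : charge S * (charge S - 1) = 0 ∨ charge S * (charge S - 1) = 2 := by
      obtain ⟨h1, h2⟩ := hc
      interval_cases charge S <;> simp
    have hww : w = w0 + w1 := by omega
    rw [if_pos (by omega), Finset.sum_eq_single (w0, w1)]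
    · rw [← hw0, ← hw1, ← hww, ← Nat.not_even_iff_odd, ← ZMod.natCast_eq_zero_iff_even]
      simp only [ne_eq, mul_eq_zero, not_or]
      tauto
    · rintro ⟨a, b⟩ hab hne
      rw [Finset.HasAntidiagonal.mem_antidiagonal] at hab
      have : w0 ≠ a := by
        rintro rfl
        apply hne
        simp only at hab
        rw [show b = w1 by omega]
      simp only
      rw [pathPar_id_eq_zero (n := a) (hw0 ▸ this), zero_mul, mul_zero]
    · intro h
      exact absurd (Finset.HasAntidiagonal.mem_antidiagonal.2 hww.symm) h
  · have hbig : ∀ d : ℤ, ¬ (-1 ≤ d ∧ d ≤ 2) → 4 < d * (d - 1) := by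
      intro d hd
      rcases le_or_gt d (-2) with h | h
      · nlinarith
      · have : 3 ≤ d := by omega
        nlinarith
    have := hbig _ hc
    rw [if_neg (by omega)]
    simp only [ne_eq, not_true_eq_false, false_iff]
    tauto

/-! ### Binary digits -/

/-- The binary expansions of `a` and `b` have no common digit. -/
def BitDisjoint (a b : ℕ) : Prop := ∀ i, ¬ (a.testBit i = true ∧ b.testBit i = true)

lemma BitDisjoint.symm {a b : ℕ} (h : BitDisjoint a b) : BitDisjoint b a :=
  fun i hi => h i ⟨hi.2, hi.1⟩

lemma bitDisjoint_comm {a b : ℕ} : BitDisjoint a b ↔ BitDisjoint b a :=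
  ⟨BitDisjoint.symm, BitDisjoint.symm⟩

lemma bitDisjoint_iff_div {a b : ℕ} :
    BitDisjoint a b ↔ ¬ (a % 2 = 1 ∧ b % 2 = 1) ∧ BitDisjoint (a / 2) (b / 2) := by
  constructor
  · intro h
    refine ⟨fun hab => h 0 (by simpa [Nat.testBit_zero] using hab), fun i hi => h (i + 1) ?_⟩
    rwa [Nat.testBit_succ, Nat.testBit_succ]
  · rintro ⟨h0, h⟩ i
    cases i with
    | zero => simpa [Nat.testBit_zero] using h0
    | succ i => rw [Nat.testBit_succ, Nat.testBit_succ]; exact h i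

lemma bitDisjoint_two_mul_add {a b c d : ℕ} (hc : c ≤ 1) (hd : d ≤ 1) :
    BitDisjoint (2 * a + c) (2 * b + d) ↔ ¬ (c = 1 ∧ d = 1) ∧ BitDisjoint a b := by
  rw [bitDisjoint_iff_div, show (2 * a + c) % 2 = c by omega, show (2 * b + d) % 2 = d by omega,
    show (2 * a + c) / 2 = a by omega, show (2 * b + d) / 2 = b by omega]

lemma odd_choose_add_iff (a b : ℕ) : Odd ((a + b).choose a) ↔ BitDisjoint a b := by
  induction hn : a + b using Nat.strong_induction_on generalizing a b with
  | _ n ih =>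
    subst hn
    by_cases h0 : a + b = 0
    · obtain ⟨rfl, rfl⟩ : a = 0 ∧ b = 0 := by omega
      simp [BitDisjoint]
    have : Fact (Nat.Prime 2) := ⟨Nat.prime_two⟩
    have hl := Choose.choose_modEq_choose_mod_mul_choose_div_nat (n := a + b) (k := a) (p := 2)
    rw [bitDisjoint_iff_div, Nat.odd_iff, hl]
    by_cases hab : a % 2 = 1 ∧ b % 2 = 1
    · rw [show (a + b) % 2 = 0 by omega, hab.1, hab.2]
      simp
    · have hd : (a + b) / 2 = a / 2 + b / 2 := by omega
      have h1 : ((a + b) % 2).choose (a % 2) = 1 := by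
        rcases Nat.mod_two_eq_zero_or_one a with h | h
        · rw [h, Nat.choose_zero_right]
        · rw [h, show (a + b) % 2 = 1 by omega, Nat.choose_self]
      rw [h1, one_mul, hd, ← Nat.odd_iff, ih _ (by omega) (a / 2) (b / 2) rfl]
      tauto

lemma BitDisjoint.testBit_add {a b : ℕ} (h : BitDisjoint a b) (i : ℕ) :
    (a + b).testBit i = true ↔ a.testBit i = true ∨ b.testBit i = true := by
  induction i generalizing a b with
  | zero =>
    have := (bitDisjoint_iff_div.1 h).1
    simp only [Nat.testBit_zero, decide_eq_true_eq]
    omega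
  | succ i ih =>
    obtain ⟨h0, h1⟩ := bitDisjoint_iff_div.1 h
    rw [Nat.testBit_succ, Nat.testBit_succ, Nat.testBit_succ,
      show (a + b) / 2 = a / 2 + b / 2 by omega, ih h1]

lemma BitDisjoint.regroup {a b c d : ℕ} (hab : BitDisjoint a b) (hcd : BitDisjoint c d)
    (h : BitDisjoint (a + b) (c + d)) :
    BitDisjoint a c ∧ BitDisjoint b d ∧ BitDisjoint (a + c) (b + d) := by
  have key : ∀ i, ¬ ((a.testBit i = true ∨ b.testBit i = true) ∧
      (c.testBit i = true ∨ d.testBit i = true)) := fun i => by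
    rw [← hab.testBit_add, ← hcd.testBit_add]; exact h i
  have hac : BitDisjoint a c := fun i => by have := key i; tauto
  have hbd : BitDisjoint b d := fun i => by have := key i; tauto
  refine ⟨hac, hbd, fun i => ?_⟩
  rw [hac.testBit_add, hbd.testBit_add]
  have := key i
  have := hab i
  have := hcd i
  tauto

/-- `A` is the position of the smallest binary digit of `n` that is at least `i`. -/
def IsLowBit (i n A : ℕ) : Prop :=
  i ≤ A ∧ n.testBit A = true ∧ ∀ l, i ≤ l → l < A → ¬ n.testBit l = true

lemma exists_isLowBit {i n : ℕ} (h : 2 ^ i ≤ n) : ∃ A, IsLowBit i n A := by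
  have hex : ∃ A, i ≤ A ∧ n.testBit A = true := Nat.exists_ge_and_testBit_of_ge_two_pow h
  refine ⟨Nat.find hex, (Nat.find_spec hex).1, (Nat.find_spec hex).2, fun l h1 h2 h3 => ?_⟩
  exact Nat.find_min hex h2 ⟨h1, h3⟩

lemma IsLowBit.succ {i n A : ℕ} (h : IsLowBit (i + 1) n (A + 1)) : IsLowBit i (n / 2) A := by
  refine ⟨by have := h.1; omega, by rw [← Nat.testBit_succ]; exact h.2.1, fun l h1 h2 => ?_⟩
  rw [← Nat.testBit_succ]
  exact h.2.2 (l + 1) (by omega) (by omega)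

lemma bitDisjoint_sub_one_iff {a b A : ℕ} (h : BitDisjoint a b) (hA : IsLowBit 0 (a + b) A) :
    (1 ≤ a ∧ BitDisjoint (a - 1) b) ↔ a.testBit A = true := by
  induction A generalizing a b with
  | zero =>
    have h1 := hA.2.1
    have h2 := (bitDisjoint_iff_div.1 h)
    simp only [Nat.testBit_zero, decide_eq_true_eq] at h1 ⊢
    constructor
    · rintro ⟨h3, h4⟩
      have := (bitDisjoint_iff_div.1 h4).1
      omega
    · intro h3
      refine ⟨by omega, bitDisjoint_iff_div.2 ⟨by omega, ?_⟩⟩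
      rw [show (a - 1) / 2 = a / 2 by omega]
      exact h2.2
  | succ A ih =>
    have h1 := hA.2.2 0 le_rfl (by omega)
    have h2 := (bitDisjoint_iff_div.1 h)
    simp only [Nat.testBit_zero, decide_eq_true_eq] at h1
    have hA' : IsLowBit 0 (a / 2 + b / 2) A := by
      rw [show a / 2 + b / 2 = (a + b) / 2 by omega]
      refine ⟨by omega, by rw [← Nat.testBit_succ]; exact hA.2.1, fun l _ h2 => ?_⟩
      rw [← Nat.testBit_succ]
      exact hA.2.2 (l + 1) (by omega) (by omega)
    rw [Nat.testBit_succ, ← ih h2.2 hA', bitDisjoint_iff_div]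
    constructor
    · rintro ⟨h3, h4, h5⟩
      rw [show (a - 1) / 2 = a / 2 - 1 by omega] at h5
      exact ⟨by omega, h5⟩
    · rintro ⟨h3, h4⟩
      rw [show a / 2 - 1 = (a - 1) / 2 by omega] at h4
      exact ⟨by omega, by omega, h4⟩

lemma bitDisjoint_sub_two_pow_iff {i a b A : ℕ} (h : BitDisjoint a b)
    (hA : IsLowBit i (a + b) A) :
    (2 ^ i ≤ a ∧ BitDisjoint (a - 2 ^ i) b) ↔ a.testBit A = true := by
  induction i generalizing a b A with
  | zero => simpa using bitDisjoint_sub_one_iff h hA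
  | succ i ih =>
    obtain ⟨A, rfl⟩ : ∃ B, A = B + 1 := ⟨A - 1, by have := hA.1; omega⟩
    have h2 := (bitDisjoint_iff_div.1 h)
    have hA' : IsLowBit i (a / 2 + b / 2) A := by
      rw [show a / 2 + b / 2 = (a + b) / 2 by omega]
      exact hA.succ
    rw [Nat.testBit_succ, ← ih h2.2 hA', bitDisjoint_iff_div, pow_succ]
    have hd : (a - 2 ^ i * 2) / 2 = a / 2 - 2 ^ i := by omega
    constructor
    · rintro ⟨h3, h4, h5⟩
      rw [hd] at h5
      exact ⟨by omega, h5⟩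
    · rintro ⟨h3, h4⟩
      rw [← hd] at h4
      exact ⟨by omega, by omega, h4⟩

/-- An odd pair of bead sets whose weights have no common binary digit. -/
def OddPair (X Y : Finset ℕ) : Prop :=
  OddBeads X ∧ OddBeads Y ∧ BitDisjoint (weight X) (weight Y)

lemma OddPair.symm {X Y : Finset ℕ} (h : OddPair X Y) : OddPair Y X := ⟨h.2.1, h.1, h.2.2.symm⟩

lemma oddBeads_iff_oddPair (S : Finset ℕ) :
    OddBeads S ↔ OddPair (half 0 S) (half 1 S) ∧ -1 ≤ charge S ∧ charge S ≤ 2 := by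
  rw [oddBeads_iff_half, odd_choose_add_iff]
  unfold OddPair
  tauto

lemma weight_half_of_charge {S : Finset ℕ} (h : -1 ≤ charge S ∧ charge S ≤ 2) :
    ((charge S = 0 ∨ charge S = 1) ∧
      weight S = 2 * (weight (half 0 S) + weight (half 1 S)) + 0) ∨
    ((charge S = -1 ∨ charge S = 2) ∧
      weight S = 2 * (weight (half 0 S) + weight (half 1 S)) + 1) := by
  have hw := two_mul_weight_half S
  obtain ⟨h1, h2⟩ := h
  obtain h | h | h | h : charge S = -1 ∨ charge S = 0 ∨ charge S = 1 ∨ charge S = 2 := by omega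
  all_goals rw [h] at hw; omega

lemma oddPair_iff_half (X Y : Finset ℕ) :
    OddPair X Y ↔ OddPair (half 0 X) (half 0 Y) ∧ OddPair (half 1 X) (half 1 Y) ∧
      BitDisjoint (weight (half 0 X) + weight (half 0 Y))
        (weight (half 1 X) + weight (half 1 Y)) ∧
      (-1 ≤ charge X ∧ charge X ≤ 2) ∧ (-1 ≤ charge Y ∧ charge Y ≤ 2) ∧
      ¬ ((charge X = -1 ∨ charge X = 2) ∧ (charge Y = -1 ∨ charge Y = 2)) := by
  have key : (-1 ≤ charge X ∧ charge X ≤ 2) → (-1 ≤ charge Y ∧ charge Y ≤ 2) →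
      (BitDisjoint (weight X) (weight Y) ↔
        ¬ ((charge X = -1 ∨ charge X = 2) ∧ (charge Y = -1 ∨ charge Y = 2)) ∧
        BitDisjoint (weight (half 0 X) + weight (half 1 X))
          (weight (half 0 Y) + weight (half 1 Y))) := by
    intro hX hY
    rcases weight_half_of_charge hX with ⟨hx, hX'⟩ | ⟨hx, hX'⟩ <;>
    rcases weight_half_of_charge hY with ⟨hy, hY'⟩ | ⟨hy, hY'⟩ <;>
    rw [hX', hY', bitDisjoint_two_mul_add (by omega) (by omega)] <;>
    refine and_congr_left fun _ => ?_ <;> omega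
  constructor
  · rintro ⟨hX, hY, hXY⟩
    rw [oddBeads_iff_oddPair] at hX hY
    obtain ⟨⟨hX0, hX1, hX01⟩, hcX⟩ := hX
    obtain ⟨⟨hY0, hY1, hY01⟩, hcY⟩ := hY
    obtain ⟨hne, hd⟩ := (key hcX hcY).1 hXY
    obtain ⟨h1, h2, h3⟩ := hX01.regroup hY01 hd
    exact ⟨⟨hX0, hY0, h1⟩, ⟨hX1, hY1, h2⟩, h3, hcX, hcY, hne⟩
  · rintro ⟨⟨hX0, hY0, h1⟩, ⟨hX1, hY1, h2⟩, h3, hcX, hcY, hne⟩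
    obtain ⟨hX01, hY01, hd⟩ := h1.regroup h2 h3
    exact ⟨(oddBeads_iff_oddPair X).2 ⟨⟨hX0, hX1, hX01⟩, hcX⟩,
      (oddBeads_iff_oddPair Y).2 ⟨⟨hY0, hY1, hY01⟩, hcY⟩, (key hcX hcY).2 ⟨hne, hd⟩⟩

/-! ### Moving a bead between two bead sets -/

lemma half_erase_self {r : ℕ} (hr : r < 2) (X : Finset ℕ) (y : ℕ) :
    half r (X.erase (2 * y + r)) = (half r X).erase y := by
  ext z
  rw [mem_half hr, Finset.mem_erase, Finset.mem_erase, mem_half hr]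
  refine and_congr_left fun _ => ?_
  omega

lemma half_erase_of_ne {r s : ℕ} (hr : r < 2) (hs : s < 2) (hrs : r ≠ s) (X : Finset ℕ) (y : ℕ) :
    half r (X.erase (2 * y + s)) = half r X := by
  ext z
  rw [mem_half hr, Finset.mem_erase, mem_half hr, and_iff_right]
  omega

lemma half_insert_self {r : ℕ} (hr : r < 2) (X : Finset ℕ) (y : ℕ) :
    half r (insert (2 * y + r) X) = insert y (half r X) := by
  ext z
  rw [mem_half hr, Finset.mem_insert, Finset.mem_insert, mem_half hr]
  refine or_congr_left ?_
  omega

lemma half_insert_of_ne {r s : ℕ} (hr : r < 2) (hs : s < 2) (hrs : r ≠ s) (X : Finset ℕ) (y : ℕ) :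
    half r (insert (2 * y + s) X) = half r X := by
  ext z
  rw [mem_half hr, Finset.mem_insert, mem_half hr, or_iff_right]
  omega

/-- The bead `y` can be transferred from `X` to `Y` so as to obtain an odd pair again. -/
def CanCross (X Y : Finset ℕ) (y : ℕ) : Prop :=
  y ∈ X ∧ y ∉ Y ∧ OddPair (X.erase y) (insert y Y)

lemma weight_cross {X Y : Finset ℕ} {y : ℕ} (hX : y ∈ X) (hY : y ∉ Y) :
    (weight (X.erase y) + weight (insert y Y) : ℤ) =
      weight X + weight Y + X.card - 1 - Y.card := by
  have h1 := two_mul_weight X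
  have h2 := two_mul_weight Y
  have h3 := two_mul_weight (X.erase y)
  have h4 := two_mul_weight (insert y Y)
  rw [Finset.sum_insert hY, Finset.card_insert_of_notMem hY] at h4
  have h5 := Finset.add_sum_erase X (fun x => (x : ℤ)) hX
  have h6 : (X.card : ℤ) = (X.erase y).card + 1 := by exact_mod_cast (Finset.card_erase_add_one hX).symm
  rw [← h5, h6] at h1
  rw [h6]
  push_cast at h4
  nlinarith

/-- The condition on the charges in the description of odd pairs by runners. -/
def ChargeOK (c d : ℤ) : Prop :=
  (-1 ≤ c ∧ c ≤ 2) ∧ (-1 ≤ d ∧ d ≤ 2) ∧ ¬ ((c = -1 ∨ c = 2) ∧ (d = -1 ∨ d = 2))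

lemma card_half_erase {r : ℕ} (hr : r < 2) {X : Finset ℕ} {y : ℕ} (hy : 2 * y + r ∈ X) :
    (((half r X).erase y).card : ℤ) = (half r X).card - 1 := by
  have := Finset.card_erase_add_one ((mem_half hr).2 hy)
  omega

lemma card_half_insert {r : ℕ} (hr : r < 2) {X : Finset ℕ} {y : ℕ} (hy : 2 * y + r ∉ X) :
    ((insert y (half r X)).card : ℤ) = (half r X).card + 1 := by
  rw [Finset.card_insert_of_notMem fun h => hy ((mem_half hr).1 h)]
  push_cast
  rfl

lemma canCross_even_iff {X Y : Finset ℕ} (h1 : OddPair (half 1 X) (half 1 Y)) (y : ℕ) :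
    CanCross X Y (2 * y + 0) ↔ CanCross (half 0 X) (half 0 Y) y ∧
      BitDisjoint (weight ((half 0 X).erase y) + weight (insert y (half 0 Y)))
        (weight (half 1 X) + weight (half 1 Y)) ∧ ChargeOK (charge X - 1) (charge Y + 1) := by
  unfold CanCross ChargeOK
  rw [← mem_half (by omega), ← mem_half (by omega)]
  by_cases hX : y ∈ half 0 X
  · by_cases hY : y ∈ half 0 Y
    · simp [hY]
    · have cX : charge (X.erase (2 * y + 0)) = charge X - 1 := by
        unfold charge
        rw [half_erase_self (by omega), half_erase_of_ne (by omega) (by omega) (by omega),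
          card_half_erase (by omega) ((mem_half (by omega)).1 hX)]
        ring
      have cY : charge (insert (2 * y + 0) Y) = charge Y + 1 := by
        unfold charge
        rw [half_insert_self (by omega), half_insert_of_ne (by omega) (by omega) (by omega),
          card_half_insert (by omega) (fun h => hY ((mem_half (by omega)).2 h))]
        ring
      rw [oddPair_iff_half, half_erase_self (by omega),
        half_erase_of_ne (by omega) (by omega) (by omega), half_insert_self (by omega),
        half_insert_of_ne (by omega) (by omega) (by omega), cX, cY]
      tauto
  · simp [hX]

lemma canCross_odd_iff {X Y : Finset ℕ} (h0 : OddPair (half 0 X) (half 0 Y)) (y : ℕ) :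
    CanCross X Y (2 * y + 1) ↔ CanCross (half 1 X) (half 1 Y) y ∧
      BitDisjoint (weight ((half 1 X).erase y) + weight (insert y (half 1 Y)))
        (weight (half 0 X) + weight (half 0 Y)) ∧ ChargeOK (charge X + 1) (charge Y - 1) := by
  unfold CanCross ChargeOK
  rw [← mem_half (by omega), ← mem_half (by omega)]
  by_cases hX : y ∈ half 1 X
  · by_cases hY : y ∈ half 1 Y
    · simp [hY]
    · have cX : charge (X.erase (2 * y + 1)) = charge X + 1 := by
        unfold charge
        rw [half_erase_self (by omega), half_erase_of_ne (by omega) (by omega) (by omega),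
          card_half_erase (by omega) ((mem_half (by omega)).1 hX)]
        ring
      have cY : charge (insert (2 * y + 1) Y) = charge Y - 1 := by
        unfold charge
        rw [half_insert_self (by omega), half_insert_of_ne (by omega) (by omega) (by omega),
          card_half_insert (by omega) (fun h => hY ((mem_half (by omega)).2 h))]
        ring
      rw [oddPair_iff_half, half_erase_self (by omega),
        half_erase_of_ne (by omega) (by omega) (by omega), half_insert_self (by omega),
        half_insert_of_ne (by omega) (by omega) (by omega), cX, cY,
        bitDisjoint_comm (a := weight ((half 1 X).erase y) + weight (insert y (half 1 Y)))]
      tauto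
  · simp [hX]

lemma existsUnique_of_runner {P Q : ℕ → Prop} {r s : ℕ} (hrs : r < 2 ∧ s < 2 ∧ r ≠ s)
    (h : ∃! y, Q y) (hr : ∀ y, P (2 * y + r) ↔ Q y) (hs : ∀ y, ¬ P (2 * y + s)) :
    ∃! x, P x := by
  obtain ⟨y, hy, huniq⟩ := h
  refine ⟨2 * y + r, (hr y).2 hy, fun x hx => ?_⟩
  by_cases hxr : x % 2 = r
  · have hx' : x = 2 * (x / 2) + r := by omega
    rw [hx'] at hx
    have := huniq _ ((hr _).1 hx)
    omega
  · have hx' : x = 2 * (x / 2) + s := by omega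
    rw [hx'] at hx
    exact absurd hx (hs _)

theorem existsUnique_canCross {X Y : Finset ℕ} (h : OddPair X Y)
    (hc : X.card = Y.card + 1 ∨ (X.card = Y.card ∧ 0 < weight X + weight Y)) :
    ∃! y, CanCross X Y y := by
  induction hN : weight X + weight Y using Nat.strong_induction_on generalizing X Y with
  | _ N ih =>
    by_cases h0 : N = 0
    · have hc' : X.card = Y.card + 1 := by omega
      have hX := weight_eq_zero_iff.1 (show weight X = 0 by omega)
      have hY := weight_eq_zero_iff.1 (show weight Y = 0 by omega)
      rw [hc'] at hX
      have hXY : X = insert Y.card Y := by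
        conv_rhs => rw [hY]
        rw [hX, Finset.range_add_one, Finset.card_range]
      have hn : Y.card ∉ Y := by
        intro hmem
        rw [hY, Finset.card_range] at hmem
        simp at hmem
      refine ⟨Y.card, ⟨?_, hn, ?_⟩, ?_⟩
      · rw [hXY]; simp
      · have : X.erase Y.card = Y := by rw [hXY, Finset.erase_insert hn]
        rw [this, ← hXY]
        exact h.symm
      · rintro y ⟨hy1, hy2, _⟩
        rw [hXY, Finset.mem_insert] at hy1
        tauto
    · obtain ⟨P0, P1, hD, hcX, hcY, hne⟩ := (oddPair_iff_half X Y).1 h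
      have hwX := weight_half_of_charge hcX
      have hwY := weight_half_of_charge hcY
      have hcardX := card_half X
      have hcardY := card_half Y
      have echX : charge X = (half 0 X).card - (half 1 X).card := rfl
      have echY : charge Y = (half 0 Y).card - (half 1 Y).card := rfl
      set t0 := weight (half 0 X) + weight (half 0 Y) with ht0
      set t1 := weight (half 1 X) + weight (half 1 Y) with ht1
      have cross0 : ∀ y, CanCross (half 0 X) (half 0 Y) y →
          (weight ((half 0 X).erase y) + weight (insert y (half 0 Y)) : ℤ) =
            t0 + (half 0 X).card - 1 - (half 0 Y).card := fun y hy => by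
        rw [weight_cross hy.1 hy.2.1, ht0]; push_cast; ring
      have cross1 : ∀ y, CanCross (half 1 X) (half 1 Y) y →
          (weight ((half 1 X).erase y) + weight (insert y (half 1 Y)) : ℤ) =
            t1 + (half 1 X).card - 1 - (half 1 Y).card := fun y hy => by
        rw [weight_cross hy.1 hy.2.1, ht1]; push_cast; ring
      have htri : (ChargeOK (charge X - 1) (charge Y + 1) ∧ ¬ ChargeOK (charge X + 1) (charge Y - 1)
            ∧ (half 0 X).card = (half 0 Y).card + 1) ∨
          (¬ ChargeOK (charge X - 1) (charge Y + 1) ∧ ChargeOK (charge X + 1) (charge Y - 1)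
            ∧ (half 1 X).card = (half 1 Y).card + 1) ∨
          (ChargeOK (charge X - 1) (charge Y + 1) ∧ ChargeOK (charge X + 1) (charge Y - 1)
            ∧ (half 0 X).card = (half 0 Y).card ∧ (half 1 X).card = (half 1 Y).card
            ∧ N = 2 * (t0 + t1)) := by
        unfold ChargeOK
        obtain ⟨hcX1, hcX2⟩ := hcX
        obtain ⟨hcY1, hcY2⟩ := hcY
        obtain hx | hx | hx | hx :
          charge X = -1 ∨ charge X = 0 ∨ charge X = 1 ∨ charge X = 2 := by omega
        all_goals
          obtain hy | hy | hy | hy :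
            charge Y = -1 ∨ charge Y = 0 ∨ charge Y = 1 ∨ charge Y = 2 := by omega
        all_goals
          rw [hx] at hwX hne echX
          rw [hy] at hwY hne echY
          rw [hx, hy]
          omega
      rcases htri with ⟨hE, hO, hcard⟩ | ⟨hE, hO, hcard⟩ | ⟨hE, hO, hcard0, hcard1, hNt⟩
      · refine existsUnique_of_runner (r := 0) (s := 1) (by omega)
          (ih t0 (by omega) P0 (Or.inl hcard) rfl) (fun y => ?_) (fun y hy => ?_)
        · rw [canCross_even_iff P1]
          refine ⟨fun hy => hy.1, fun hy => ⟨hy, ?_, hE⟩⟩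
          have := cross0 y hy
          rwa [show weight ((half 0 X).erase y) + weight (insert y (half 0 Y)) = t0 by omega]
        · exact hO ((canCross_odd_iff P0 y).1 hy).2.2
      · refine existsUnique_of_runner (r := 1) (s := 0) (by omega)
          (ih t1 (by omega) P1 (Or.inl hcard) rfl) (fun y => ?_) (fun y hy => ?_)
        · rw [canCross_odd_iff P0]
          refine ⟨fun hy => hy.1, fun hy => ⟨hy, ?_, hO⟩⟩
          have := cross1 y hy
          rw [show weight ((half 1 X).erase y) + weight (insert y (half 1 Y)) = t1 by omega]
          exact hD.symm
        · exact hE ((canCross_even_iff P1 y).1 hy).2.2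
      · obtain ⟨A, hA⟩ := exists_isLowBit (i := 0) (n := t0 + t1) (by rw [pow_zero]; omega)
        have b0 := bitDisjoint_sub_one_iff hD hA
        have b1 := bitDisjoint_sub_one_iff hD.symm (by rwa [add_comm t1 t0])
        have hor := (hD.testBit_add A).1 hA.2.1
        have hnand := hD A
        by_cases hb : t0.testBit A = true
        · have hb1 : ¬ t1.testBit A = true := fun h => hnand ⟨hb, h⟩
          obtain ⟨hpos, hdis⟩ := b0.2 hb
          refine existsUnique_of_runner (r := 0) (s := 1) (by omega)
            (ih t0 (by omega) P0 (Or.inr ⟨hcard0, by omega⟩) rfl) (fun y => ?_) (fun y hy => ?_)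
          · rw [canCross_even_iff P1]
            refine ⟨fun hy => hy.1, fun hy => ⟨hy, ?_, hE⟩⟩
            have := cross0 y hy
            rwa [show weight ((half 0 X).erase y) + weight (insert y (half 0 Y)) = t0 - 1 by omega]
          · obtain ⟨hy1, hy2, -⟩ := (canCross_odd_iff P0 y).1 hy
            have := cross1 y hy1
            refine hb1 (b1.1 ⟨by omega, ?_⟩)
            rwa [show weight ((half 1 X).erase y) + weight (insert y (half 1 Y)) = t1 - 1 by omega]
              at hy2
        · obtain ⟨hpos, hdis⟩ := b1.2 (hor.resolve_left hb)
          refine existsUnique_of_runner (r := 1) (s := 0) (by omega)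
            (ih t1 (by omega) P1 (Or.inr ⟨hcard1, by omega⟩) rfl) (fun y => ?_) (fun y hy => ?_)
          · rw [canCross_odd_iff P0]
            refine ⟨fun hy => hy.1, fun hy => ⟨hy, ?_, hO⟩⟩
            have := cross1 y hy
            rwa [show weight ((half 1 X).erase y) + weight (insert y (half 1 Y)) = t1 - 1 by omega]
          · obtain ⟨hy1, hy2, -⟩ := (canCross_even_iff P1 y).1 hy
            have := cross0 y hy1
            refine hb (b0.1 ⟨by omega, ?_⟩)
            rwa [show weight ((half 0 X).erase y) + weight (insert y (half 0 Y)) = t0 - 1 by omega]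
              at hy2

/-! ### Sliding a bead along a bead set -/

/-- Sliding the bead `x` of `S` down by `2 ^ j` is possible and gives an odd bead set. -/
def CanMove (j : ℕ) (S : Finset ℕ) (x : ℕ) : Prop :=
  x ∈ S ∧ 2 ^ j ≤ x ∧ x - 2 ^ j ∉ S ∧ OddBeads (move (2 ^ j) S x)

lemma oddBeads_shift (S : Finset ℕ) : OddBeads (shift S) ↔ OddBeads S := by
  unfold OddBeads
  rw [partOfBeta_shift]

lemma weight_shift (S : Finset ℕ) : weight (shift S) = weight S := by
  unfold weight
  rw [partOfBeta_shift]

lemma half_zero_shift (S : Finset ℕ) : half 0 (shift S) = shift (half 1 S) := by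
  ext y
  rw [mem_half (by omega), mem_shift, mem_shift, mem_half (by omega)]
  by_cases hy : y = 0
  · simp [hy]
  · rw [show 2 * (y - 1) + 1 = 2 * y + 0 - 1 by omega]
    simp [hy, Nat.pos_of_ne_zero hy]

lemma half_one_shift (S : Finset ℕ) : half 1 (shift S) = half 0 S := by
  ext y
  rw [mem_half (by omega), mem_shift, mem_half (by omega)]
  simp

lemma charge_shift (S : Finset ℕ) : charge (shift S) = 1 - charge S := by
  unfold charge
  rw [half_zero_shift, half_one_shift, card_shift]
  push_cast
  ring

lemma half_shift_shift {r : ℕ} (hr : r < 2) (S : Finset ℕ) :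
    half r (shift (shift S)) = shift (half r S) := by
  obtain rfl | rfl : r = 0 ∨ r = 1 := by omega
  · rw [half_zero_shift, half_one_shift]
  · rw [half_one_shift, half_zero_shift]

lemma move_shift {e x : ℕ} (hex : e ≤ x) (S : Finset ℕ) :
    move e (shift S) (x + 1) = shift (move e S x) := by
  ext y
  unfold move
  simp only [Finset.mem_insert, Finset.mem_erase, mem_shift]
  by_cases hy : y = 0
  · simp [hy]
  · simp only [hy, Nat.pos_of_ne_zero hy, true_and, false_or]
    rw [show y = x + 1 - e ↔ y - 1 = x - e by omega, show y ≠ x + 1 ↔ y - 1 ≠ x by omega]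

lemma canMove_shift_succ (j : ℕ) (S : Finset ℕ) {x : ℕ} (hx : 2 ^ j ≤ x) :
    CanMove j (shift S) (x + 1) ↔ CanMove j S x := by
  unfold CanMove
  rw [move_shift hx, oddBeads_shift, mem_shift, mem_shift, Nat.add_sub_cancel,
    show x + 1 - 2 ^ j - 1 = x - 2 ^ j by omega]
  simp [hx, show 2 ^ j ≤ x + 1 by omega, show x + 1 - 2 ^ j ≠ 0 by omega,
    show 0 < x + 1 - 2 ^ j by omega]

lemma CanMove.exists_eq_succ {j : ℕ} {S : Finset ℕ} {x : ℕ} (h : CanMove j (shift S) x) :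
    ∃ y, 2 ^ j ≤ y ∧ x = y + 1 := by
  obtain ⟨-, h2, h3, -⟩ := h
  have hpos : 0 < 2 ^ j := Nat.two_pow_pos j
  have : x ≠ 2 ^ j := by
    rintro rfl
    exact h3 (mem_shift.2 (Or.inl (Nat.sub_self _)))
  exact ⟨x - 1, by omega, by omega⟩

lemma existsUnique_canMove_shift (j : ℕ) (S : Finset ℕ) :
    (∃! x, CanMove j (shift S) x) ↔ ∃! x, CanMove j S x := by
  constructor
  · rintro ⟨x, hx, hu⟩
    obtain ⟨y, hy, rfl⟩ := hx.exists_eq_succ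
    refine ⟨y, (canMove_shift_succ j S hy).1 hx, fun z hz => ?_⟩
    have := hu _ ((canMove_shift_succ j S hz.2.1).2 hz)
    omega
  · rintro ⟨y, hy, hu⟩
    refine ⟨y + 1, (canMove_shift_succ j S hy.2.1).2 hy, fun z hz => ?_⟩
    obtain ⟨w, hw, rfl⟩ := hz.exists_eq_succ
    rw [hu w ((canMove_shift_succ j S hw).1 hz)]

lemma half_move_self {r : ℕ} (hr : r < 2) {e y : ℕ} (hey : e ≤ y) (S : Finset ℕ) :
    half r (move (2 * e) S (2 * y + r)) = move e (half r S) y := by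
  unfold move
  rw [show 2 * y + r - 2 * e = 2 * (y - e) + r by omega, half_insert_self hr, half_erase_self hr]

lemma half_move_of_ne {r s : ℕ} (hr : r < 2) (hs : s < 2) (hrs : r ≠ s) {e y : ℕ} (hey : e ≤ y)
    (S : Finset ℕ) : half r (move (2 * e) S (2 * y + s)) = half r S := by
  unfold move
  rw [show 2 * y + s - 2 * e = 2 * (y - e) + s by omega, half_insert_of_ne hr hs hrs,
    half_erase_of_ne hr hs hrs]

lemma canMove_succ_iff {j A : ℕ} {S : Finset ℕ} (h : OddBeads S)
    (hA : IsLowBit j (weight (half 0 S) + weight (half 1 S)) A) {r : ℕ} (hr : r < 2) (y : ℕ) :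
    CanMove (j + 1) S (2 * y + r) ↔
      CanMove j (half r S) y ∧ (weight (half r S)).testBit A = true := by
  have hpow : 2 ^ (j + 1) = 2 * 2 ^ j := by ring
  obtain ⟨⟨h0, h1, hD⟩, hc⟩ := (oddBeads_iff_oddPair S).1 h
  unfold CanMove
  rw [hpow, mem_half hr]
  by_cases hy : 2 ^ j ≤ y
  swap
  · simp [hy, show ¬ 2 * 2 ^ j ≤ 2 * y + r by omega]
  rw [mem_half hr, show 2 * y + r - 2 * 2 ^ j = 2 * (y - 2 ^ j) + r by omega]
  by_cases hx : 2 * y + r ∈ S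
  swap
  · simp [hx]
  by_cases hx' : 2 * (y - 2 ^ j) + r ∈ S
  · simp [hx']
  have e1 := (mem_half hr).2 hx
  have e2 : y - 2 ^ j ∉ half r S := fun h => hx' ((mem_half hr).1 h)
  have hw := weight_move e1 hy e2
  have hcard := card_move e1 e2
  simp only [hx, hx', hy, show 2 * 2 ^ j ≤ 2 * y + r by omega, true_and, not_false_eq_true]
  rw [oddBeads_iff_oddPair]
  obtain rfl | rfl : r = 0 ∨ r = 1 := by omega
  · have hch : charge (move (2 * 2 ^ j) S (2 * y + 0)) = charge S := by
      unfold charge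
      rw [half_move_self hr hy, half_move_of_ne (by omega) hr (by omega) hy, hcard]
    rw [hch, half_move_self hr hy, half_move_of_ne (by omega) hr (by omega) hy,
      ← bitDisjoint_sub_two_pow_iff hD hA]
    unfold OddPair
    rw [show weight (move (2 ^ j) (half 0 S) y) = weight (half 0 S) - 2 ^ j by omega]
    have : 2 ^ j ≤ weight (half 0 S) := by omega
    tauto
  · have hch : charge (move (2 * 2 ^ j) S (2 * y + 1)) = charge S := by
      unfold charge
      rw [half_move_self hr hy, half_move_of_ne (by omega) hr (by omega) hy, hcard]
    rw [hch, half_move_self hr hy, half_move_of_ne (by omega) hr (by omega) hy,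
      ← bitDisjoint_sub_two_pow_iff hD.symm (by rwa [add_comm])]
    unfold OddPair
    rw [show weight (move (2 ^ j) (half 1 S) y) = weight (half 1 S) - 2 ^ j by omega,
      bitDisjoint_comm]
    have : 2 ^ j ≤ weight (half 1 S) := by omega
    tauto

lemma canMove_zero_odd_iff {S : Finset ℕ} (hc : charge S = -1 ∨ charge S = 0) (y : ℕ) :
    CanMove 0 S (2 * y + 1) ↔ CanCross (half 1 S) (half 0 S) y := by
  unfold CanMove CanCross
  rw [pow_zero, Nat.add_sub_cancel, mem_half (by omega), mem_half (by omega),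
    oddBeads_iff_oddPair]
  have e0 : half 0 (move 1 S (2 * y + 1)) = insert y (half 0 S) := by
    unfold move
    rw [Nat.add_sub_cancel, ← add_zero (2 * y), half_insert_self (by omega), add_zero,
      half_erase_of_ne (by omega) (by omega) (by omega)]
  have e1 : half 1 (move 1 S (2 * y + 1)) = (half 1 S).erase y := by
    unfold move
    rw [Nat.add_sub_cancel, ← add_zero (2 * y), half_insert_of_ne (by omega) (by omega) (by omega),
      add_zero, half_erase_self (by omega)]
  rw [e0, e1, add_zero]
  by_cases hx : 2 * y + 1 ∈ S
  swap
  · simp [hx]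
  by_cases hx' : 2 * y ∈ S
  · simp [hx']
  have hch : charge (move 1 S (2 * y + 1)) = charge S + 2 := by
    unfold charge
    rw [e0, e1, card_half_erase (by omega) hx, card_half_insert (r := 0) (by omega) hx']
    ring
  rw [hch]
  have hpair : OddPair (insert y (half 0 S)) ((half 1 S).erase y) ↔
      OddPair ((half 1 S).erase y) (insert y (half 0 S)) := ⟨OddPair.symm, OddPair.symm⟩
  rw [hpair]
  have : -1 ≤ charge S + 2 ∧ charge S + 2 ≤ 2 := by omega
  simp [hx, hx', this]

lemma not_canMove_zero_even {S : Finset ℕ} (hc : charge S = -1 ∨ charge S = 0) (y : ℕ) :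
    ¬ CanMove 0 S (2 * y + 0) := by
  rintro ⟨h1, h2, h3, h4⟩
  rw [pow_zero] at h2 h3 h4
  have hy : 2 * y + 0 - 1 = 2 * (y - 1) + 1 := by omega
  rw [hy] at h3
  have e0 : half 0 (move 1 S (2 * y + 0)) = (half 0 S).erase y := by
    unfold move
    rw [hy, half_insert_of_ne (by omega) (by omega) (by omega), half_erase_self (by omega)]
  have e1 : half 1 (move 1 S (2 * y + 0)) = insert (y - 1) (half 1 S) := by
    unfold move
    rw [hy, half_insert_self (by omega), half_erase_of_ne (by omega) (by omega) (by omega)]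
  have hch : charge (move 1 S (2 * y + 0)) = charge S - 2 := by
    unfold charge
    rw [e0, e1, card_half_erase (by omega) h1, card_half_insert (by omega) h3]
    ring
  have := ((oddBeads_iff_oddPair _).1 h4).2
  omega

lemma existsUnique_canMove_zero_of_charge {S : Finset ℕ} (h : OddBeads S) (hw : 0 < weight S)
    (hc : charge S = -1 ∨ charge S = 0) : ∃! x, CanMove 0 S x := by
  obtain ⟨hP, hcS⟩ := (oddBeads_iff_oddPair S).1 h
  refine existsUnique_of_runner (r := 1) (s := 0) (by omega)
    (existsUnique_canCross hP.symm ?_) (canMove_zero_odd_iff hc) (not_canMove_zero_even hc)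
  have hwh := weight_half_of_charge hcS
  have : charge S = (half 0 S).card - (half 1 S).card := rfl
  omega

/-- An odd bead set of weight at least `2 ^ j` has exactly one bead which may be slid down by
`2 ^ j` so as to leave an odd bead set. -/
theorem existsUnique_canMove {j : ℕ} {S : Finset ℕ} (h : OddBeads S) (hj : 2 ^ j ≤ weight S) :
    ∃! x, CanMove j S x := by
  induction j generalizing S with
  | zero =>
    rw [pow_zero] at hj
    have hcS := ((oddBeads_iff_oddPair S).1 h).2
    by_cases hc : charge S ≤ 0
    · exact existsUnique_canMove_zero_of_charge h hj (by omega)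
    · rw [← existsUnique_canMove_shift]
      refine existsUnique_canMove_zero_of_charge ((oddBeads_shift S).2 h) ?_ ?_
      · rw [weight_shift]; omega
      · rw [charge_shift]; omega
  | succ j ih =>
    obtain ⟨hP, hcS⟩ := (oddBeads_iff_oddPair S).1 h
    have hwh := weight_half_of_charge hcS
    have hle : 2 ^ j ≤ weight (half 0 S) + weight (half 1 S) := by
      rw [pow_succ] at hj
      omega
    obtain ⟨A, hA⟩ := exists_isLowBit hle
    have hmove := fun r hr y => canMove_succ_iff h hA (r := r) hr y
    have hpow : 2 ^ j ≤ 2 ^ A := Nat.pow_le_pow_right (by omega) hA.1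
    have hnand := hP.2.2 A
    rcases (hP.2.2.testBit_add A).1 hA.2.1 with hb | hb
    · refine existsUnique_of_runner (r := 0) (s := 1) (by omega)
        (ih hP.1 (hpow.trans (Nat.ge_two_pow_of_testBit hb))) (fun y => ?_) (fun y => ?_)
      · rw [hmove 0 (by omega), and_iff_left hb]
      · rw [hmove 1 (by omega)]
        exact fun h => hnand ⟨hb, h.2⟩
    · refine existsUnique_of_runner (r := 1) (s := 0) (by omega)
        (ih hP.2.1 (hpow.trans (Nat.ge_two_pow_of_testBit hb))) (fun y => ?_) (fun y => ?_)
      · rw [hmove 1 (by omega), and_iff_left hb]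
      · rw [hmove 0 (by omega)]
        exact fun h => hnand ⟨h.2, hb⟩

/-! ### Hook removal and 2-quotients of odd partitions -/

lemma oddP_partOfBeta_iff (S : Finset ℕ) : OddP (partOfBeta S) ↔ OddBeads S :=
  and_iff_right fun _ => pos_of_mem_partOfBeta

/-- The partition `mu` arises from an odd slide in the bead set of `lam` with `M` beads. -/
def SlidesTo (j : ℕ) (lam : Multiset ℕ) (M : ℕ) (mu : Multiset ℕ) : Prop :=
  ∃ x, CanMove j (betaSet lam M) x ∧ mu = partOfBeta (move (2 ^ j) (betaSet lam M) x)

lemma slidesTo_succ_iff {j M : ℕ} {lam mu : Multiset ℕ} (hpos : ∀ x ∈ lam, 0 < x)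
    (hM : Multiset.card lam ≤ M) : SlidesTo j lam (M + 1) mu ↔ SlidesTo j lam M mu := by
  unfold SlidesTo
  rw [betaSet_succ hpos hM]
  constructor
  · rintro ⟨x, hx, rfl⟩
    obtain ⟨y, hy, rfl⟩ := hx.exists_eq_succ
    exact ⟨y, (canMove_shift_succ j _ hy).1 hx, by rw [move_shift hy, partOfBeta_shift]⟩
  · rintro ⟨y, hy, rfl⟩
    exact ⟨y + 1, (canMove_shift_succ j _ hy.2.1).2 hy, by
      rw [move_shift hy.2.1, partOfBeta_shift]⟩

lemma slidesTo_iff_card {j M : ℕ} {lam mu : Multiset ℕ} (hpos : ∀ x ∈ lam, 0 < x)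
    (hM : Multiset.card lam ≤ M) :
    SlidesTo j lam M mu ↔ SlidesTo j lam (Multiset.card lam) mu := by
  induction M, hM using Nat.le_induction with
  | base => rfl
  | succ M hM ih => rw [slidesTo_succ_iff hpos hM, ih]

lemma isHookRemoval_and_oddP_iff {j M : ℕ} {lam mu : Multiset ℕ} (hpos : ∀ x ∈ lam, 0 < x)
    (hM : Multiset.card lam ≤ M) :
    (IsHookRemoval (2 ^ j) lam mu ∧ OddP mu) ↔ SlidesTo j lam M mu := by
  constructor
  · rintro ⟨⟨-, hmu, -, m, x, h1, h2, h3, h4, h5, h6⟩, hodd⟩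
    have hmu' : mu = partOfBeta (move (2 ^ j) (betaSet lam m) x) := by
      rw [← partOfBeta_betaSet hmu h2, h6]
      rfl
    rw [slidesTo_iff_card hpos hM, ← slidesTo_iff_card hpos h1]
    refine ⟨x, ⟨h3, h4, h5, ?_⟩, hmu'⟩
    rw [← oddP_partOfBeta_iff, ← hmu']
    exact hodd
  · rintro ⟨x, ⟨h3, h4, h5, h6⟩, rfl⟩
    have hc : (move (2 ^ j) (betaSet lam M) x).card = M := by
      rw [card_move h3 h5, card_betaSet]
    refine ⟨⟨hpos, fun _ => pos_of_mem_partOfBeta, Nat.two_pow_pos j, M, x, hM,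
      (card_partOfBeta_le _).trans hc.le, h3, h4, h5, ?_⟩, (oddP_partOfBeta_iff _).2 h6⟩
    have := betaSet_partOfBeta (move (2 ^ j) (betaSet lam M) x)
    rwa [hc] at this

lemma fkOp_partOfBeta {j x : ℕ} {S : Finset ℕ} (h : OddBeads S) (hx : CanMove j S x) :
    fkOp j (partOfBeta S) = partOfBeta (move (2 ^ j) S x) := by
  have hiff := fun mu => isHookRemoval_and_oddP_iff (j := j) (mu := mu)
    (fun _ => pos_of_mem_partOfBeta) (card_partOfBeta_le S)
  unfold SlidesTo at hiff
  rw [betaSet_partOfBeta] at hiff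
  have hex : ∃ mu, IsHookRemoval (2 ^ j) (partOfBeta S) mu ∧ OddP mu :=
    ⟨_, (hiff _).2 ⟨x, hx, rfl⟩⟩
  unfold fkOp
  rw [dif_pos hex]
  obtain ⟨y, hy, hmu⟩ := (hiff _).1 hex.choose_spec
  have hw := weight_move hx.1 hx.2.1 hx.2.2.1
  rw [hmu, (existsUnique_canMove h (by omega)).unique hy hx]

lemma quot2_aux {M : ℕ} {lam : Multiset ℕ} (hpos : ∀ x ∈ lam, 0 < x)
    (hM : Multiset.card lam ≤ M) {r : ℕ} (hr : r < 2) (d : ℕ) :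
    partOfBeta (half r (betaSet lam (M + 2 * d))) = partOfBeta (half r (betaSet lam M)) := by
  induction d with
  | zero => rfl
  | succ d ih =>
    rw [show M + 2 * (d + 1) = M + 2 * d + 1 + 1 by ring, betaSet_succ hpos (by omega),
      betaSet_succ hpos (by omega), half_shift_shift hr, partOfBeta_shift, ih]

lemma quot2_partOfBeta {S : Finset ℕ} (hS : Even S.card) :
    quot2 (partOfBeta S) = (partOfBeta (half 0 S), partOfBeta (half 1 S)) := by
  have key : ∀ r < 2, partOfBeta (half r (betaSet (partOfBeta S)
      (2 * Multiset.card (partOfBeta S)))) = partOfBeta (half r S) := fun r hr => by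
    obtain ⟨m, hm⟩ := hS
    have hc := card_partOfBeta_le S
    rw [← quot2_aux (fun _ => pos_of_mem_partOfBeta) (by omega) hr m]
    conv_rhs => rw [← betaSet_partOfBeta S]
    rw [← quot2_aux (fun _ => pos_of_mem_partOfBeta) hc hr (Multiset.card (partOfBeta S)), hm]
    congr 3
    ring
  exact Prod.ext (key 0 (by omega)) (key 1 (by omega))

lemma OddP.exists_beads {lam : Multiset ℕ} (h : OddP lam) :
    ∃ S, Even S.card ∧ OddBeads S ∧ partOfBeta S = lam := by
  have hS : partOfBeta (betaSet lam (2 * Multiset.card lam)) = lam :=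
    partOfBeta_betaSet h.1 (by omega)
  refine ⟨betaSet lam (2 * Multiset.card lam), ?_, ?_, hS⟩
  · rw [card_betaSet]
    exact even_two_mul _
  · rw [← oddP_partOfBeta_iff, hS]
    exact h

lemma OddP.sum_fkOp {j : ℕ} {lam : Multiset ℕ} (h : OddP lam) (hj : 2 ^ j ≤ lam.sum) :
    (fkOp j lam).sum + 2 ^ j = lam.sum := by
  obtain ⟨S, -, hS, rfl⟩ := h.exists_beads
  obtain ⟨x, hx, -⟩ := existsUnique_canMove hS hj
  rw [fkOp_partOfBeta hS hx]
  exact weight_move hx.1 hx.2.1 hx.2.2.1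

lemma OddP.quot2_spec {lam : Multiset ℕ} (h : OddP lam) :
    OddP (quot2 lam).1 ∧ OddP (quot2 lam).2 ∧
      BitDisjoint (quot2 lam).1.sum (quot2 lam).2.sum ∧
      lam.sum / 2 = (quot2 lam).1.sum + (quot2 lam).2.sum := by
  obtain ⟨S, hc, hS, rfl⟩ := h.exists_beads
  obtain ⟨⟨h0, h1, hD⟩, hch⟩ := (oddBeads_iff_oddPair S).1 hS
  rw [quot2_partOfBeta hc]
  refine ⟨(oddP_partOfBeta_iff _).2 h0, (oddP_partOfBeta_iff _).2 h1, hD, ?_⟩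
  have := weight_half_of_charge hch
  change weight S / 2 = weight (half 0 S) + weight (half 1 S)
  omega

lemma quot2_fkOp_succ {j A : ℕ} {lam : Multiset ℕ} (h : OddP lam)
    (hA : IsLowBit (j + 1) lam.sum (A + 1)) :
    ((quot2 lam).1.sum.testBit A = true →
      quot2 (fkOp (j + 1) lam) = (fkOp j (quot2 lam).1, (quot2 lam).2)) ∧
    ((quot2 lam).2.sum.testBit A = true →
      quot2 (fkOp (j + 1) lam) = ((quot2 lam).1, fkOp j (quot2 lam).2)) := by
  have hA' := hA.succ
  rw [h.quot2_spec.2.2.2] at hA'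
  obtain ⟨S, hc, hS, rfl⟩ := h.exists_beads
  obtain ⟨⟨h0, h1, hD⟩, hch⟩ := (oddBeads_iff_oddPair S).1 hS
  rw [quot2_partOfBeta hc] at hA' ⊢
  have hpow : 2 ^ j ≤ 2 ^ A := Nat.pow_le_pow_right (by omega) hA'.1
  have hpow' : 2 ^ (j + 1) = 2 * 2 ^ j := by ring
  constructor
  · intro hb
    obtain ⟨y, hy, -⟩ := existsUnique_canMove h0 (hpow.trans (Nat.ge_two_pow_of_testBit hb))
    have hx := (canMove_succ_iff hS hA' (by omega) y).2 ⟨hy, hb⟩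
    rw [fkOp_partOfBeta hS hx, fkOp_partOfBeta h0 hy,
      quot2_partOfBeta (by rwa [card_move hx.1 hx.2.2.1]), hpow',
      half_move_self (by omega) hy.2.1, half_move_of_ne (by omega) (by omega) (by omega) hy.2.1]
  · intro hb
    obtain ⟨y, hy, -⟩ := existsUnique_canMove h1 (hpow.trans (Nat.ge_two_pow_of_testBit hb))
    have hx := (canMove_succ_iff hS hA' (by omega) y).2 ⟨hy, hb⟩
    rw [fkOp_partOfBeta hS hx, fkOp_partOfBeta h1 hy,
      quot2_partOfBeta (by rwa [card_move hx.1 hx.2.2.1]), hpow',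
      half_move_self (by omega) hy.2.1, half_move_of_ne (by omega) (by omega) (by omega) hy.2.1]

/-! ### Rows of the 2-quotient tower -/

lemma towerRow_succ_eq_append (k : ℕ) (lam : Multiset ℕ) :
    towerRow (k + 1) lam = towerRow k (quot2 lam).1 ++ towerRow k (quot2 lam).2 := by
  induction k with
  | zero => rfl
  | succ k ih =>
    rw [towerRow, ih, List.flatMap_append]
    rfl

lemma length_towerRow (k : ℕ) (lam : Multiset ℕ) : (towerRow k lam).length = 2 ^ k := by
  induction k generalizing lam with
  | zero => rfl
  | succ k ih => rw [towerRow_succ_eq_append, List.length_append, ih, ih, pow_succ, mul_two]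

lemma towerRow_succ_getD_left {k s : ℕ} (lam : Multiset ℕ) (hs : s < 2 ^ k) :
    (towerRow (k + 1) lam).getD s 0 = (towerRow k (quot2 lam).1).getD s 0 := by
  rw [towerRow_succ_eq_append, List.getD_append _ _ _ _ (by rwa [length_towerRow])]

lemma towerRow_succ_getD_right {k s : ℕ} (lam : Multiset ℕ) :
    (towerRow (k + 1) lam).getD (2 ^ k + s) 0 = (towerRow k (quot2 lam).2).getD s 0 := by
  rw [towerRow_succ_eq_append, List.getD_append_right _ _ _ _ (by rw [length_towerRow]; omega),
    length_towerRow, Nat.add_sub_cancel_left]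

lemma OddP.testBit_succ_iff {lam : Multiset ℕ} (h : OddP lam) (i : ℕ) :
    lam.sum.testBit (i + 1) = true ↔
      (quot2 lam).1.sum.testBit i = true ∨ (quot2 lam).2.sum.testBit i = true := by
  rw [Nat.testBit_succ, h.quot2_spec.2.2.2, h.quot2_spec.2.2.1.testBit_add]

lemma OddP.testBit_of_towerRow {k s i : ℕ} {lam : Multiset ℕ} (h : OddP lam) (hs : s < 2 ^ k)
    (hi : ((towerRow k lam).getD s 0).sum.testBit i = true) :
    lam.sum.testBit (i + k) = true := by
  induction k generalizing lam s with
  | zero =>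
    obtain rfl : s = 0 := by rw [pow_zero] at hs; omega
    exact hi
  | succ k ih =>
    rw [← add_assoc, h.testBit_succ_iff]
    by_cases hsk : s < 2 ^ k
    · rw [towerRow_succ_getD_left lam hsk] at hi
      exact Or.inl (ih h.quot2_spec.1 hsk hi)
    · obtain ⟨s', rfl⟩ := Nat.exists_eq_add_of_le (not_lt.1 hsk)
      rw [towerRow_succ_getD_right] at hi
      exact Or.inr (ih h.quot2_spec.2.1 (by rw [pow_succ] at hs; omega) hi)

/-- Passing to `fkOp j lam` changes exactly one component of the `k`-th row, namely the one
whose size contains the digit inherited from the lowest digit `A ≥ j` of the size of `lam`. -/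
theorem exists_towerRow_fkOp {k j A : ℕ} {lam : Multiset ℕ} (h : OddP lam)
    (hA : IsLowBit j lam.sum A) (hkj : k ≤ j) :
    ∃ s < 2 ^ k, (∀ s' < 2 ^ k, ((towerRow k lam).getD s' 0).sum.testBit (A - k) = true ↔ s' = s) ∧
      OddP ((towerRow k lam).getD s 0) ∧
      towerRow k (fkOp j lam) =
        (towerRow k lam).set s (fkOp (j - k) ((towerRow k lam).getD s 0)) := by
  induction k generalizing j A lam with
  | zero =>
    refine ⟨0, by simp, fun s' hs' => ?_, h, rfl⟩
    obtain rfl : s' = 0 := by rw [pow_zero] at hs'; omega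
    simpa [towerRow] using hA.2.1
  | succ k ih =>
    obtain ⟨j, rfl⟩ : ∃ i, j = i + 1 := ⟨j - 1, by omega⟩
    obtain ⟨A, rfl⟩ : ∃ i, A = i + 1 := ⟨A - 1, by have := hA.1; omega⟩
    have hkj' : k ≤ j := by omega
    have hjA : j ≤ A := by have := hA.1; omega
    obtain ⟨h0, h1, hD, -⟩ := h.quot2_spec
    have hbit := h.testBit_succ_iff
    have hnand := hD A
    have hrow := quot2_fkOp_succ h hA
    have hpow : 2 ^ (k + 1) = 2 ^ k + 2 ^ k := by ring
    rw [Nat.add_sub_add_right, Nat.add_sub_add_right, towerRow_succ_eq_append k (fkOp _ _)]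
    rcases (hbit A).1 hA.2.1 with hb | hb
    · have hlow : IsLowBit j (quot2 lam).1.sum A := ⟨hjA, hb, fun l h2 h3 h4 =>
        hA.2.2 (l + 1) (by omega) (by omega) ((hbit l).2 (Or.inl h4))⟩
      obtain ⟨s, hs, huniq, hodd, hset⟩ := ih h0 hlow hkj'
      refine ⟨s, by omega, fun s' hs' => ?_, ?_, ?_⟩
      · by_cases hsk : s' < 2 ^ k
        · rw [towerRow_succ_getD_left lam hsk, huniq s' hsk]
        · obtain ⟨s'', rfl⟩ := Nat.exists_eq_add_of_le (not_lt.1 hsk)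
          rw [towerRow_succ_getD_right]
          refine iff_of_false (fun hi => hnand ⟨hb, ?_⟩) (by omega)
          have := h1.testBit_of_towerRow (by omega) hi
          rwa [Nat.sub_add_cancel (hkj'.trans hjA)] at this
      · rwa [towerRow_succ_getD_left lam hs]
      · rw [hrow.1 hb, towerRow_succ_getD_left lam hs, towerRow_succ_eq_append,
          List.set_append_left _ _ (by rwa [length_towerRow]), hset]
    · have hlow : IsLowBit j (quot2 lam).2.sum A := ⟨hjA, hb, fun l h2 h3 h4 =>
        hA.2.2 (l + 1) (by omega) (by omega) ((hbit l).2 (Or.inr h4))⟩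
      obtain ⟨s, hs, huniq, hodd, hset⟩ := ih h1 hlow hkj'
      refine ⟨2 ^ k + s, by omega, fun s' hs' => ?_, ?_, ?_⟩
      · by_cases hsk : s' < 2 ^ k
        · rw [towerRow_succ_getD_left lam hsk]
          refine iff_of_false (fun hi => hnand ⟨?_, hb⟩) (by omega)
          have := h0.testBit_of_towerRow hsk hi
          rwa [Nat.sub_add_cancel (hkj'.trans hjA)] at this
        · obtain ⟨s'', rfl⟩ := Nat.exists_eq_add_of_le (not_lt.1 hsk)
          rw [towerRow_succ_getD_right, huniq s'' (by omega)]
          omega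
      · rwa [towerRow_succ_getD_right]
      · rw [hrow.2 hb, towerRow_succ_getD_right, towerRow_succ_eq_append,
          List.set_append_right _ _ (by rw [length_towerRow]; omega), length_towerRow,
          Nat.add_sub_cancel_left, hset]

lemma Rcomp_eq {k j s : ℕ} {lam : Multiset ℕ} (hs : s < 2 ^ k)
    (hodd : OddP ((towerRow k lam).getD s 0))
    (hsum : 2 ^ (j - k) ≤ ((towerRow k lam).getD s 0).sum)
    (hset : towerRow k (fkOp j lam) =
      (towerRow k lam).set s (fkOp (j - k) ((towerRow k lam).getD s 0))) :
    Rcomp k j lam = (towerRow k lam).getD s 0 := by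
  have hex : ∃ s, s < 2 ^ k ∧ towerRow k (fkOp j lam) =
      (towerRow k lam).set s (fkOp (j - k) ((towerRow k lam).getD s 0)) := ⟨s, hs, hset⟩
  unfold Rcomp
  rw [dif_pos hex]
  by_cases hne : hex.choose = s
  · rw [hne]
  have hlen : s < (towerRow k lam).length := by rwa [length_towerRow]
  have hself : ∀ x, ((towerRow k lam).set s x).getD s 0 = x := fun x => by
    rw [List.getD_eq_getElem?_getD, List.getElem?_set_self hlen, Option.getD_some]
  have hother : ∀ x, ((towerRow k lam).set hex.choose x).getD s 0 = (towerRow k lam).getD s 0 :=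
    fun x => by
      rw [List.getD_eq_getElem?_getD, List.getElem?_set_ne hne, ← List.getD_eq_getElem?_getD]
  have hcomp := hset.symm.trans hex.choose_spec.2
  apply_fun fun l => (l.getD s 0).sum at hcomp
  rw [hself, hother] at hcomp
  have := hodd.sum_fkOp hsum
  have := Nat.two_pow_pos (j - k)
  omega

lemma testBit_sum_two_pow_iff {ι : Type*} {I : Finset ι} {a : ι → ℕ} (ha : Set.InjOn a I)
    (l : ℕ) : (∑ i ∈ I, 2 ^ a i).testBit l = true ↔ ∃ i ∈ I, a i = l := by
  rw [← Finset.sum_image (f := fun m => 2 ^ m) ha, ← Nat.mem_bitIndices, ← List.mem_toFinset,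
    Finset.toFinset_bitIndices_sum_two_pow, Finset.mem_image]

theorem stmt4 (n r : ℕ) (a : ℕ → ℕ)
    (hdec : ∀ i j, 1 ≤ i → i < j → j ≤ r → a j < a i)
    (hn : n = ∑ i ∈ Finset.Icc 1 r, 2 ^ a i)
    (lam : Multiset ℕ) (hodd : OddP lam) (hsum : lam.sum = n)
    (j k : ℕ) (hj : 2 ^ j ≤ n) (hkj : k ≤ j)
    (t : ℕ) (ht : t ∈ Finset.Icc 1 r) (hat : j ≤ a t)
    (htmin : ∀ i ∈ Finset.Icc 1 r, j ≤ a i → a t ≤ a i) :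
    (∃! s, s < 2 ^ k ∧ Nat.testBit ((towerRow k lam).getD s 0).sum (a t - k)) ∧
    ∀ s, s < 2 ^ k → Nat.testBit ((towerRow k lam).getD s 0).sum (a t - k) →
      Rcomp k j lam = (towerRow k lam).getD s 0 := by
  have hinj : Set.InjOn a (Finset.Icc 1 r) := by
    intro i hi i' hi' hii
    simp only [Finset.coe_Icc, Set.mem_Icc] at hi hi'
    rcases lt_trichotomy i i' with hlt | heq | hlt
    · exact absurd hii (hdec i i' hi.1 hlt hi'.2).ne'
    · exact heq
    · exact absurd hii (hdec i' i hi'.1 hlt hi.2).ne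
  have hbit : ∀ l, n.testBit l = true ↔ ∃ i ∈ Finset.Icc 1 r, a i = l := by
    rw [hn]
    exact testBit_sum_two_pow_iff hinj
  have hA : IsLowBit j lam.sum (a t) := by
    rw [hsum]
    refine ⟨hat, (hbit _).2 ⟨t, ht, rfl⟩, fun l h1 h2 h3 => ?_⟩
    obtain ⟨i, hi, rfl⟩ := (hbit l).1 h3
    exact absurd (htmin i hi h1) (by omega)
  obtain ⟨s, hs, huniq, hodds, hset⟩ := exists_towerRow_fkOp hodd hA hkj
  have hb := (huniq s hs).2 rfl
  refine ⟨⟨s, ⟨hs, hb⟩, fun s' hs' => (huniq s' hs'.1).1 hs'.2⟩, fun s' hs' hb' => ?_⟩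
  obtain rfl := (huniq s' hs').1 hb'
  have hpow : 2 ^ (j - k) ≤ 2 ^ (a t - k) := Nat.pow_le_pow_right (by omega) (by omega)
  exact Rcomp_eq hs hodds (hpow.trans (Nat.ge_two_pow_of_testBit hb)) hset

end OddSym
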